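/- arXiv:1101.1065 — 5 statements merged into one kernel-verified Lean document; each statement's English description precedes it below -/
import Mathlib

section
/- For every d ≥ 1 and N ≥ 1 there exists a POVM {E^i}_{i=1}^N on A⊗A'^N (where A ≅ ℂ^d and A'^N = (ℂ^d)^{⊗N}) such that the port-based teleportation channel ℰ: M_d(ℂ) → M_d(ℂ) associated with this POVM has entanglement fidelity F(ℰ) ≥ 1 − (d²−1)/N. -/
open scoped ComplexOrder

/-- A POVM on a finite-dimensional Hilbert space: a finite family of positive semidefinite
operators summing to the identity. -/
def IsPOVM {ι H : Type*} [Fintype ι] [Fintype H] [DecidableEq H]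
    (E : ι → Matrix H H ℂ) : Prop :=
  (∀ i, (E i).PosSemidef) ∧ (∑ i, E i) = 1

/-- The maximally entangled state `|Φ_d⟩⟨Φ_d|`, `|Φ_d⟩ = (1/√d) ∑ i, |i⟩⊗|i⟩`, as a matrix. -/
noncomputable def maxEnt (d : ℕ) : Matrix (Fin d × Fin d) (Fin d × Fin d) ℂ :=
  Matrix.of fun p q => if p.1 = p.2 ∧ q.1 = q.2 then (1 : ℂ) / d else 0

/-- The tensor extension `Ch ⊗ id_K` of a map on matrices, defined entrywise. -/
def tensorId {A B : Type*} (Ch : Matrix A A ℂ → Matrix B B ℂ) (K : Type*) :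
    Matrix (A × K) (A × K) ℂ → Matrix (B × K) (B × K) ℂ :=
  fun L => Matrix.of fun p q =>
    Ch (Matrix.of fun a a' => L (a, p.2) (a', q.2)) p.1 q.1

/-- The port-based teleportation channel associated with a POVM `{E^i}_{i=1}^N` on
`A ⊗ A'^N` (with `A ≅ ℂ^d`, `A'^N = (ℂ^d)^{⊗N}`, indexed by `Fin d × (Fin N → Fin d)`):
`ℰ(ρ) = ∑ i, tr_{B'^N∖B'_i} tr_{A A'^N} [(I_{B'^N} ⊗ E^i)(ρ ⊗ (|Φ_d⟩⟨Φ_d|)^{⊗N}_{A'^N B'^N})]`,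
written out entrywise (the sum over all `h : Fin N → Fin d` together with the extra factor
`1/d` accounts for the partial trace over the ports `B'_j`, `j ≠ i`, since the value of `h`
at `i` is overridden). -/
noncomputable def pbtChannel (d N : ℕ)
    (E : Fin N → Matrix (Fin d × (Fin N → Fin d)) (Fin d × (Fin N → Fin d)) ℂ) :
    Matrix (Fin d) (Fin d) ℂ → Matrix (Fin d) (Fin d) ℂ :=
  fun ρ => Matrix.of fun b b' =>
    (1 / (d : ℂ) ^ (N + 1)) * ∑ i : Fin N, ∑ h : Fin N → Fin d, ∑ a : Fin d, ∑ a' : Fin d,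
      E i (a, Function.update h i b') (a', Function.update h i b) * ρ a' a

/-- The entanglement fidelity `F(ℰ) = tr[|Φ_d⟩⟨Φ_d| (ℰ ⊗ id_d)(|Φ_d⟩⟨Φ_d|)]`. -/
noncomputable def entFidelity (d : ℕ)
    (Ch : Matrix (Fin d) (Fin d) ℂ → Matrix (Fin d) (Fin d) ℂ) : ℝ :=
  ((maxEnt d * tensorId Ch (Fin d) (maxEnt d)).trace).re

open scoped Matrix

section PrettyGoodMeasurement

variable {H : Type*} [Fintype H]

lemma three_mul_sub_sq_le_two_mul_sqrt {t : ℝ} (ht : 0 ≤ t) : 3 * t - t ^ 2 ≤ 2 * √t := by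
  obtain ⟨u, hu, rfl⟩ : ∃ u : ℝ, 0 ≤ u ∧ t = u ^ 2 :=
    ⟨√t, Real.sqrt_nonneg t, (Real.sq_sqrt ht).symm⟩
  rw [Real.sqrt_sq hu]
  nlinarith [mul_nonneg hu (mul_nonneg (sq_nonneg (u - 1)) (by linarith : 0 ≤ u + 2))]

/-- The tangent inequality for `√` at `c`, in a form that can be summed over eigenvalues. -/
lemma sqrt_tangent {c s : ℝ} (hc : 0 < c) (hs : 0 ≤ s) :
    (3 * s - s ^ 2 / c) / (2 * √c) ≤ s * (√s)⁻¹ := by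
  have hsc : 0 < √c := Real.sqrt_pos.2 hc
  have h := three_mul_sub_sq_le_two_mul_sqrt (div_nonneg hs hc.le)
  rw [← div_eq_mul_inv, Real.div_sqrt, div_le_iff₀ (by positivity)]
  rw [Real.sqrt_div hs] at h
  have h' := mul_le_mul_of_nonneg_left h hc.le
  have e1 : c * (3 * (s / c) - (s / c) ^ 2) = 3 * s - s ^ 2 / c := by field_simp
  have e2 : c * (2 * (√s / √c)) = √s * (2 * √c) := by
    nth_rewrite 1 [← Real.mul_self_sqrt hc.le]
    field_simp
  rwa [e1, e2] at h'

/-- A positive semidefinite matrix has a Hermitian inverse square root on its support. -/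
lemma Matrix.PosSemidef.exists_inv_sqrt [DecidableEq H] {S : Matrix H H ℂ} (hS : S.PosSemidef) :
    ∃ X : Matrix H H ℂ, X.IsHermitian ∧ (1 - X * S * X).PosSemidef ∧
      ∀ c : ℝ, 0 < c →
        (3 * S.trace.re - (S * S).trace.re / c) / (2 * √c) ≤ (S * X).trace.re := by
  have hSh := hS.isHermitian
  set U : Matrix H H ℂ := (hSh.eigenvectorUnitary : Matrix H H ℂ) with hU
  set e := hSh.eigenvalues with he
  have hUU : Uᴴ * U = 1 := Unitary.coe_star_mul_self hSh.eigenvectorUnitary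
  have hUU' : U * Uᴴ = 1 := Unitary.coe_mul_star_self hSh.eigenvectorUnitary
  let D (f : H → ℝ) : Matrix H H ℂ := U * Matrix.diagonal (fun i => (f i : ℂ)) * Uᴴ
  have hSD : S = D e := by
    have := hSh.spectral_theorem
    rw [Unitary.conjStarAlgAut_apply] at this
    exact this
  have hmul (f g : H → ℝ) : D f * D g = D (fun i => f i * g i) := by
    simp only [D]
    calc _ = U * Matrix.diagonal (fun i => (f i : ℂ)) * (Uᴴ * U) *
          Matrix.diagonal (fun i => (g i : ℂ)) * Uᴴ := by simp only [Matrix.mul_assoc]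
      _ = _ := by
        rw [hUU, Matrix.mul_one, Matrix.mul_assoc U, Matrix.diagonal_mul_diagonal]
        simp
  have htr (f : H → ℝ) : (D f).trace.re = ∑ i, f i := by
    simp only [D]
    rw [Matrix.trace_mul_comm, ← Matrix.mul_assoc, hUU, Matrix.one_mul, Matrix.trace_diagonal]
    simp
  have hone : (1 : Matrix H H ℂ) = D (fun _ => 1) := by simp [D, hUU']
  have hsub (f g : H → ℝ) : D f - D g = D (fun i => f i - g i) := by
    simp only [D]
    rw [← Matrix.sub_mul, ← Matrix.mul_sub, Matrix.diagonal_sub]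
    simp
  have hpos (f : H → ℝ) (hf : ∀ i, 0 ≤ f i) : (D f).PosSemidef :=
    (Matrix.PosSemidef.diagonal (fun i => by simpa using hf i)).mul_mul_conjTranspose_same U
  have he0 (i : H) : 0 ≤ e i := hS.eigenvalues_nonneg i
  refine ⟨D fun i => (√(e i))⁻¹, (hpos _ fun i => by positivity).isHermitian, ?_, fun c hc => ?_⟩
  · rw [hSD, hmul, hmul, hone, hsub]
    refine hpos _ fun i => ?_
    rcases (he0 i).eq_or_lt with h | h
    · simp [← h]
    · have : √(e i) ≠ 0 := (Real.sqrt_pos.2 h).ne'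
      have h2 : (√(e i))⁻¹ * e i * (√(e i))⁻¹ = 1 := by
        nth_rewrite 2 [← Real.mul_self_sqrt h.le]
        field_simp
      simp [h2]
  · rw [hSD, hmul, hmul, htr, htr, htr]
    calc _ = ∑ i, (3 * e i - e i ^ 2 / c) / (2 * √c) := by
          rw [← Finset.sum_div, Finset.sum_sub_distrib, Finset.mul_sum, Finset.sum_div]
          simp [pow_two]
      _ ≤ _ := Finset.sum_le_sum fun i _ => sqrt_tangent hc (he0 i)

lemma trace_mul_re_nonneg_of_projection {R P : Matrix H H ℂ} (hR : R.PosSemidef)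
    (hP : P.IsHermitian) (hPP : P * P = P) : 0 ≤ (R * P).trace.re := by
  have h : (Pᴴ * R * P).trace = (R * P).trace := by
    rw [hP.eq, Matrix.trace_mul_comm, ← Matrix.mul_assoc, hPP, Matrix.trace_mul_comm]
  rw [← h]
  exact (Complex.le_def.1 (hR.conjTranspose_mul_mul_same P).trace_nonneg).1

lemma trace_projection_sandwich_ge {P X : Matrix H H ℂ} (hP : P.IsHermitian) (hPP : P * P = P)
    (hX : X.IsHermitian) (l : ℝ) :
    2 * l * (P * X).trace.re - l ^ 2 * P.trace.re ≤ (X * P * X * P).trace.re := by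
  set Y : Matrix H H ℂ := P * X * P - (l : ℂ) • P with hY
  have hYh : Yᴴ = Y := by
    simp [hY, Matrix.conjTranspose_sub, Matrix.conjTranspose_mul, hP.eq, hX.eq, Matrix.mul_assoc]
  have hnn : 0 ≤ (Yᴴ * Y).trace.re :=
    (Complex.le_def.1 (Matrix.posSemidef_conjTranspose_mul_self Y).trace_nonneg).1
  have hP' (Z : Matrix H H ℂ) : P * (P * Z) = P * Z := by rw [← Matrix.mul_assoc, hPP]
  have t1 : (P * (X * P)).trace = (P * X).trace := by
    rw [Matrix.trace_mul_comm, Matrix.mul_assoc, hPP, Matrix.trace_mul_comm]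
  have t2 : (P * (X * (P * (X * P)))).trace = (X * P * X * P).trace := by
    rw [Matrix.trace_mul_comm]
    simp only [Matrix.mul_assoc, hPP]
  have hexp : (Yᴴ * Y).trace =
      (X * P * X * P).trace - 2 * (l : ℂ) * (P * X).trace + (l : ℂ) ^ 2 * P.trace := by
    rw [hYh, hY]
    simp only [Matrix.sub_mul, Matrix.mul_sub, Matrix.smul_mul, Matrix.mul_smul, Matrix.mul_assoc,
      hP', hPP, Matrix.trace_sub, Matrix.trace_smul, t1, t2, smul_eq_mul]
    ring
  rw [hexp] at hnn
  have hre : ((X * P * X * P).trace - 2 * (l : ℂ) * (P * X).trace + (l : ℂ) ^ 2 * P.trace).re =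
      (X * P * X * P).trace.re - 2 * l * (P * X).trace.re + l ^ 2 * P.trace.re := by
    simp [pow_two]
  linarith

/-- The pretty good measurement for a family of projections `P i`, bounded through the first two
moments of `∑ i, P i`. -/
theorem exists_povm_of_projections [DecidableEq H] {ι : Type*} [Fintype ι] [Nonempty ι]
    (P : ι → Matrix H H ℂ) (hP : ∀ i, (P i).IsHermitian) (hPP : ∀ i, P i * P i = P i)
    {T c : ℝ} (hc : 0 < c) (hT : (∑ i, P i).trace.re = T)
    (hT2 : ((∑ i, P i) * ∑ i, P i).trace.re = c * T) :
    ∃ E : ι → Matrix H H ℂ, IsPOVM E ∧ T / c ≤ ∑ i, (E i * P i).trace.re := by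
  have hPpos (i : ι) : (P i).PosSemidef := by
    rw [← hPP i]
    nth_rewrite 1 [← (hP i).eq]
    exact Matrix.posSemidef_conjTranspose_mul_self _
  obtain ⟨X, hX, hR, hXtr⟩ :=
    (Matrix.posSemidef_sum Finset.univ fun i _ => hPpos i).exists_inv_sqrt
  set S := ∑ i, P i with hS
  set n : ℝ := (Fintype.card ι : ℝ) with hn
  have hn0 : 0 < n := by rw [hn]; exact_mod_cast Fintype.card_pos
  set R := 1 - X * S * X with hRdef
  have hR' : (((n⁻¹ : ℝ) : ℂ) • R).PosSemidef :=
    hR.smul (by exact_mod_cast (inv_nonneg.2 hn0.le))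
  refine ⟨fun i => X * P i * X + ((n⁻¹ : ℝ) : ℂ) • R, ⟨fun i => ?_, ?_⟩, ?_⟩
  · refine Matrix.PosSemidef.add ?_ hR'
    have := (hPpos i).conjTranspose_mul_mul_same X
    rwa [hX.eq] at this
  · rw [Finset.sum_add_distrib, ← Finset.sum_mul, ← Finset.mul_sum, ← hS, Finset.sum_const,
      Finset.card_univ, ← Nat.cast_smul_eq_nsmul ℂ, smul_smul]
    have : ((Fintype.card ι : ℂ)) * ((n⁻¹ : ℝ) : ℂ) = 1 := by
      rw [hn]; push_cast
      exact mul_inv_cancel₀ (by exact_mod_cast Fintype.card_ne_zero)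
    rw [this, one_smul, hRdef]
    abel
  · have hsc : 0 < √c := Real.sqrt_pos.2 hc
    set l : ℝ := (√c)⁻¹ with hl
    have hl2 : l ^ 2 = c⁻¹ := by rw [hl, inv_pow, Real.sq_sqrt hc.le]
    have h1 : l * T ≤ (S * X).trace.re := by
      refine le_trans (le_of_eq ?_) (hXtr c hc)
      rw [hT, hT2, hl]
      field_simp
      ring
    have h2 : ∑ i, (P i * X).trace.re = (S * X).trace.re := by
      rw [hS, Finset.sum_mul, Matrix.trace_sum, Complex.re_sum]
    have h3 : ∑ i, (P i).trace.re = T := by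
      rw [← hT, hS, Matrix.trace_sum, Complex.re_sum]
    calc T / c = 2 * l * (l * T) - l ^ 2 * T := by rw [div_eq_mul_inv, ← hl2]; ring
      _ ≤ 2 * l * (S * X).trace.re - l ^ 2 * T := by gcongr
      _ = ∑ i, (2 * l * (P i * X).trace.re - l ^ 2 * (P i).trace.re) := by
          rw [Finset.sum_sub_distrib, ← Finset.mul_sum, ← Finset.mul_sum, h2, h3]
      _ ≤ _ := Finset.sum_le_sum fun i _ => by
          rw [Matrix.add_mul, Matrix.trace_add, Complex.add_re]
          linarith [trace_projection_sandwich_ge (hP i) (hPP i) hX l,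
            trace_mul_re_nonneg_of_projection hR' (hP i) (hPP i)]

end PrettyGoodMeasurement

section Ports

variable {d N : ℕ}

/-- The projection `|Φ_d⟩⟨Φ_d|_{A A'_i} ⊗ I` onto the maximally entangled state of `A` with the
`i`-th port. -/
noncomputable def portProj (d N : ℕ) (i : Fin N) :
    Matrix (Fin d × (Fin N → Fin d)) (Fin d × (Fin N → Fin d)) ℂ :=
  Matrix.of fun p q =>
    if p.1 = p.2 i then (if q.2 = Function.update p.2 i q.1 then (1 : ℂ) / d else 0) else 0

lemma sum_update (i : Fin N) (y : Fin d) (G : (Fin N → Fin d) → ℂ) :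
    ∑ h, G (Function.update h i y) = d * ∑ k, if k i = y then G k else 0 := by
  have hupd (x : Fin d) (r : {j // j ≠ i} → Fin d) :
      Function.update ((Equiv.funSplitAt i (Fin d)).symm (x, r)) i y =
        (Equiv.funSplitAt i (Fin d)).symm (y, r) := by
    ext j
    by_cases hj : j = i <;> simp [hj]
  rw [← (Equiv.funSplitAt i (Fin d)).symm.sum_comp, Fintype.sum_prod_type,
    ← (Equiv.funSplitAt i (Fin d)).symm.sum_comp, Fintype.sum_prod_type]
  simp only [hupd]
  rw [Finset.sum_const, Finset.sum_comm]
  simp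

lemma portProj_isHermitian (i : Fin N) : (portProj d N i).IsHermitian := by
  ext ⟨a, g⟩ ⟨a', g'⟩
  have h : (a' = g' i ∧ g = Function.update g' i a) ↔ (a = g i ∧ g' = Function.update g i a') := by
    constructor <;> rintro ⟨rfl, rfl⟩ <;> simp
  simp only [Matrix.conjTranspose_apply, portProj, Matrix.of_apply, ← ite_and, h]
  split_ifs <;> simp

lemma portProj_mul_apply (i : Fin N)
    (M : Matrix (Fin d × (Fin N → Fin d)) (Fin d × (Fin N → Fin d)) ℂ)
    (a : Fin d) (g : Fin N → Fin d) (q : Fin d × (Fin N → Fin d)) :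
    (portProj d N i * M) (a, g) q =
      if a = g i then (1 / d) * ∑ b, M (b, Function.update g i b) q else 0 := by
  simp only [Matrix.mul_apply, Fintype.sum_prod_type, portProj, Matrix.of_apply]
  split_ifs <;> simp [ite_mul, Finset.mul_sum]

lemma portProj_mul_self (hd : 1 ≤ d) (i : Fin N) :
    portProj d N i * portProj d N i = portProj d N i := by
  have hd' : (d : ℂ) ≠ 0 := by exact_mod_cast (by omega : d ≠ 0)
  ext ⟨a, g⟩ ⟨a', g'⟩
  rw [portProj_mul_apply]
  simp [portProj, hd']

/-- The trace of `portProj d N i * M`, with the sum over `A` and the ports spelled out. -/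
lemma trace_portProj_mul_eq_sum (i : Fin N)
    (M : Matrix (Fin d × (Fin N → Fin d)) (Fin d × (Fin N → Fin d)) ℂ) :
    (portProj d N i * M).trace =
      (1 / d) * ∑ g : Fin N → Fin d, ∑ b, M (b, Function.update g i b) (g i, g) := by
  simp only [Matrix.trace, Matrix.diag, Fintype.sum_prod_type, portProj_mul_apply]
  rw [Finset.sum_comm]
  simp [Finset.mul_sum]

lemma trace_portProj (i : Fin N) :
    (portProj d N i).trace = (d : ℂ) ^ N / d := by
  simp only [Matrix.trace, Matrix.diag, Fintype.sum_prod_type, portProj, Matrix.of_apply]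
  rw [Finset.sum_comm]
  simp [div_eq_mul_inv]

lemma trace_portProj_mul (hd : 1 ≤ d) {i j : Fin N} (hij : i ≠ j) :
    (portProj d N i * portProj d N j).trace = (d : ℂ) ^ N / d ^ 3 := by
  have hd' : (d : ℂ) ≠ 0 := by exact_mod_cast (by omega : d ≠ 0)
  have hcount : (d : ℂ) * ∑ g : Fin N → Fin d, (if g i = g j then (1 : ℂ) else 0) = d ^ N := by
    have h : ∑ y : Fin d, ∑ h : Fin N → Fin d,
        (if Function.update h i y j = y then (1 : ℂ) else 0) = d ^ N := by
      rw [Finset.sum_comm]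
      simp [Function.update_of_ne hij.symm]
    rw [← h, Finset.sum_congr rfl fun y _ =>
      sum_update i y (fun k => if k j = y then (1 : ℂ) else 0), ← Finset.mul_sum, Finset.sum_comm]
    congr 1
    refine Finset.sum_congr rfl fun g _ => ?_
    simp [eq_comm]
  have key (g : Fin N → Fin d) (b : Fin d) :
      (b = Function.update g i b j ∧ g = Function.update (Function.update g i b) j (g i)) ↔
        (b = g j ∧ g i = g j) := by
    rw [Function.update_of_ne hij.symm]
    refine and_congr_right fun hb => ⟨fun h => ?_, fun h => ?_⟩
    · have := congrFun h j
      simpa using this.symm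
    · subst hb
      rw [h, ← h, Function.update_eq_self, h, Function.update_eq_self]
  have hsum : (portProj d N i * portProj d N j).trace =
      (∑ g : Fin N → Fin d, (if g i = g j then (1 : ℂ) else 0)) / d ^ 2 := by
    rw [trace_portProj_mul_eq_sum, Finset.mul_sum, Finset.sum_div]
    refine Finset.sum_congr rfl fun g _ => ?_
    simp only [portProj, Matrix.of_apply, ← ite_and, key]
    simp only [ite_and, Finset.sum_ite_eq', Finset.mem_univ, if_true]
    split_ifs
    · field_simp
    · simp
  rw [hsum, div_eq_div_iff (by positivity) (by positivity), ← hcount]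
  ring

lemma entFidelity_pbtChannel (hd : 1 ≤ d)
    (E : Fin N → Matrix (Fin d × (Fin N → Fin d)) (Fin d × (Fin N → Fin d)) ℂ) :
    entFidelity d (pbtChannel d N E) =
      (∑ i, (E i * portProj d N i).trace.re) / (d : ℝ) ^ (N + 1) := by
  have hd' : (d : ℂ) ≠ 0 := by exact_mod_cast (by omega : d ≠ 0)
  have hport (i : Fin N) : ∑ x : Fin d, ∑ y : Fin d, ∑ h : Fin N → Fin d,
      E i (x, Function.update h i x) (y, Function.update h i y) =
        d ^ 2 * (E i * portProj d N i).trace := by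
    have h1 (x y : Fin d) := sum_update i y
      (fun k => E i (x, Function.update k i x) (y, k))
    simp only [Function.update_idem] at h1
    rw [Matrix.trace_mul_comm, trace_portProj_mul_eq_sum]
    calc _ = d * ∑ x, ∑ k : Fin N → Fin d, ∑ y : Fin d,
          (if k i = y then E i (x, Function.update k i x) (y, k) else 0) := by
          simp only [h1, ← Finset.mul_sum]
          congr 1
          exact Finset.sum_congr rfl fun x _ => Finset.sum_comm
      _ = d * ∑ k : Fin N → Fin d, ∑ x, E i (x, Function.update k i x) (k i, k) := by
          rw [Finset.sum_comm]
          simp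
      _ = _ := by field_simp
  have hmain : (maxEnt d * tensorId (pbtChannel d N E) (Fin d) (maxEnt d)).trace =
      (∑ i, (E i * portProj d N i).trace) / (d : ℂ) ^ (N + 1) := by
    have hsum : (maxEnt d * tensorId (pbtChannel d N E) (Fin d) (maxEnt d)).trace =
        (1 / d) * ∑ y : Fin d, ∑ x : Fin d, (1 / (d : ℂ) ^ (N + 1)) * ((1 / d) *
          ∑ i, ∑ h : Fin N → Fin d,
            E i (x, Function.update h i x) (y, Function.update h i y)) := by
      simp only [Matrix.trace, Matrix.diag, Matrix.mul_apply, Fintype.sum_prod_type, maxEnt,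
        tensorId, pbtChannel, Matrix.of_apply, ite_and, ite_mul, zero_mul, mul_ite, mul_zero,
        Finset.sum_ite_eq, Finset.sum_ite_eq', Finset.sum_ite_irrel, Finset.sum_const_zero,
        Finset.mem_univ, if_true]
      rw [Finset.sum_comm, Finset.mul_sum]
      refine Finset.sum_congr rfl fun y _ => ?_
      rw [Finset.mul_sum]
      refine Finset.sum_congr rfl fun x _ => ?_
      simp only [← Finset.sum_mul]
      ring
    have hswap : ∑ y : Fin d, ∑ x : Fin d, ∑ i, ∑ h : Fin N → Fin d,
        E i (x, Function.update h i x) (y, Function.update h i y) =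
          d ^ 2 * ∑ i, (E i * portProj d N i).trace := by
      simp only [Finset.mul_sum, ← hport]
      symm
      rw [Finset.sum_comm]
      simp only [Finset.sum_comm (s := (Finset.univ : Finset (Fin N)))]
      rw [Finset.sum_comm]
    rw [hsum]
    simp only [← Finset.mul_sum]
    rw [hswap]
    field_simp
  rw [entFidelity, hmain, ← Complex.re_sum]
  have : ((d : ℂ) ^ (N + 1)) = (((d : ℝ) ^ (N + 1) : ℝ) : ℂ) := by push_cast; rfl
  rw [this, Complex.div_ofReal_re]

end Ports

/-- **Port-based teleportation** (Ishizaka–Hiroshima).  For every `d ≥ 1` and `N ≥ 1` there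
is a POVM `{E^i}_{i=1}^N` on `A ⊗ A'^N` whose associated port-based teleportation channel
has entanglement fidelity at least `1 - (d² - 1)/N`. -/
theorem port_based_teleportation_fidelity (d N : ℕ) (hd : 1 ≤ d) (hN : 1 ≤ N) :
    ∃ E : Fin N → Matrix (Fin d × (Fin N → Fin d)) (Fin d × (Fin N → Fin d)) ℂ,
      IsPOVM E ∧
      1 - ((d : ℝ) ^ 2 - 1) / N ≤ entFidelity d (pbtChannel d N E) := by
  have : Nonempty (Fin N) := ⟨⟨0, hN⟩⟩
  have hd0 : (0 : ℝ) < d := by exact_mod_cast hd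
  have hd1 : (1 : ℝ) ≤ d := by exact_mod_cast hd
  have hN0 : (0 : ℝ) < N := by exact_mod_cast hN
  set D : ℝ := (d : ℝ) ^ 2 - 1 with hD
  have hD0 : 0 ≤ D := by nlinarith
  have hc : 0 < (N + D) / (d : ℝ) ^ 2 := by positivity
  have hT : (∑ i, portProj d N i).trace = ((N * ((d : ℝ) ^ N / d) : ℝ) : ℂ) := by
    simp [Matrix.trace_sum, trace_portProj]
  have hT2 : ((∑ i, portProj d N i) * ∑ i, portProj d N i).trace =
      ((N * ((d : ℝ) ^ N / d + (N - 1) * ((d : ℝ) ^ N / d ^ 3)) : ℝ) : ℂ) := by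
    have hrow (i : Fin N) : ∑ j, (portProj d N i * portProj d N j).trace =
        (d : ℂ) ^ N / d + (N - 1) * ((d : ℂ) ^ N / d ^ 3) := by
      rw [← Finset.add_sum_erase _ _ (Finset.mem_univ i), portProj_mul_self hd, trace_portProj,
        Finset.sum_congr rfl fun j hj => trace_portProj_mul hd (Finset.ne_of_mem_erase hj).symm]
      simp [Nat.cast_sub hN]
    simp [Finset.sum_mul_sum, Matrix.trace_sum, hrow, mul_add]
  obtain ⟨E, hE, hle⟩ := exists_povm_of_projections (portProj d N) portProj_isHermitian
    (portProj_mul_self hd) (T := N * ((d : ℝ) ^ N / d)) hc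
    (by rw [hT, Complex.ofReal_re])
    (by
      rw [hT2, Complex.ofReal_re, hD]
      field_simp
      ring)
  refine ⟨E, hE, ?_⟩
  rw [entFidelity_pbtChannel hd]
  calc 1 - D / N ≤ N / (N + D) := by
        rw [le_div_iff₀ (by positivity)]
        have h : (1 - D / N) * (N + D) = N - D ^ 2 / N := by field_simp; ring
        rw [h]
        have : 0 ≤ D ^ 2 / N := by positivity
        linarith
    _ = (N * ((d : ℝ) ^ N / d)) / ((N + D) / (d : ℝ) ^ 2) / (d : ℝ) ^ (N + 1) := by
        have : (N : ℝ) + D ≠ 0 := by positivity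
        field_simp
        ring
    _ ≤ _ := by gcongr
end

section
/- Let d ≥ 2 and let {|e^a_x⟩}_{x=1}^d for a = 0, 1, …, d be d+1 pairwise mutually unbiased orthonormal bases of ℂ^d. For x ∈ {1,…,d} define the state ρ^x = (1/(d+1)) Σ_{a=0}^d |a⟩⟨a| ⊗ |e^a_x⟩⟨e^a_x| on A⊗B with A = ℂ^{d+1}, B = ℂ^d. Then for any finite-dimensional Hilbert spaces A', B', any density matrix η on A'⊗B', any POVM {E^α}_{α∈I} on A⊗A', any POVM {F^β}_{β∈J} on B⊗B', and any function g: I×J → {1,…,d}, the success probability p_succ = (1/d) Σ_{x=1}^d Σ_{(α,β): g(α,β)=x} tr[(E^α⊗F^β)(ρ^x ⊗ η)] (tensor factors reordered so that E^α acts on A⊗A' and F^β on B⊗B') satisfies p_succ ≤ 2·dim(B')/√d. -/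
open scoped ComplexOrder

/-- A family of vectors `e x : ℂ^d`, `x : Fin d`, forms an orthonormal basis. -/
def IsONB {d : ℕ} (e : Fin d → Fin d → ℂ) : Prop :=
  ∀ x y, (∑ i, (starRingEnd ℂ) (e x i) * e y i) = if x = y then 1 else 0

/-- A family of orthonormal bases of `ℂ^d`, indexed by `a : ι`, is pairwise mutually
unbiased: `|⟨e^a_x, e^b_y⟩|² = 1/d` for all `a ≠ b` and all `x, y`. -/
def MutuallyUnbiasedBases {d : ℕ} {ι : Type*} (e : ι → Fin d → Fin d → ℂ) : Prop :=
  (∀ a, IsONB (e a)) ∧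
  ∀ a b, a ≠ b → ∀ x y, ‖∑ i, (starRingEnd ℂ) (e a x i) * e b y i‖ ^ 2 = 1 / d

/-- The state `ρ^x = (1/(d+1)) ∑ a, |a⟩⟨a| ⊗ |e^a_x⟩⟨e^a_x|` on `A ⊗ B` with
`A = ℂ^{d+1}`, `B = ℂ^d`. -/
noncomputable def rhoMUB (d : ℕ) (e : Fin (d + 1) → Fin d → Fin d → ℂ) (x : Fin d) :
    Matrix (Fin (d + 1) × Fin d) (Fin (d + 1) × Fin d) ℂ :=
  Matrix.of fun p q =>
    if p.1 = q.1 then (1 / ((d : ℂ) + 1)) * e p.1 x p.2 * (starRingEnd ℂ) (e p.1 x q.2)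
    else 0

/-- `tr[(E ⊗ F)(ρ ⊗ η)]`, where `E` acts on `A ⊗ A'`, `F` on `B ⊗ B'`, `ρ` lives on
`A ⊗ B` and `η` on `A' ⊗ B'` (tensor factors reordered appropriately). -/
noncomputable def corrProb {A A' B B' : Type*} [Fintype A] [Fintype A'] [Fintype B] [Fintype B']
    (E : Matrix (A × A') (A × A') ℂ) (F : Matrix (B × B') (B × B') ℂ)
    (ρ : Matrix (A × B) (A × B) ℂ) (η : Matrix (A' × B') (A' × B') ℂ) : ℂ :=
  ∑ a : A, ∑ a₁ : A, ∑ b : B, ∑ b₁ : B, ∑ a' : A', ∑ a₁' : A', ∑ b' : B', ∑ b₁' : B',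
    E (a, a') (a₁, a₁') * F (b, b') (b₁, b₁') * ρ (a₁, b₁) (a, b) * η (a₁', b₁') (a', b')

namespace Matrix

/-- `tr_X[(P ⊗ 1) M]`, the partial trace over `X` of `M` weighted by an operator `P` on `X`. -/
def weightedPartialTrace {X Y : Type*} [Fintype X] (P : Matrix X X ℂ)
    (M : Matrix (X × Y) (X × Y) ℂ) : Matrix Y Y ℂ :=
  of fun y y' => ∑ x, ∑ x', P x x' * M (x', y) (x, y')

/-- The partial trace of `M` over the second factor. -/
def partialTraceRight {X Y : Type*} [Fintype Y] (M : Matrix (X × Y) (X × Y) ℂ) : Matrix X X ℂ :=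
  ∑ y, M.submatrix (fun x => (x, y)) (fun x => (x, y))

variable {X Y : Type*} [Fintype Y]

theorem PosSemidef.partialTraceRight {M : Matrix (X × Y) (X × Y) ℂ} (hM : M.PosSemidef) :
    M.partialTraceRight.PosSemidef :=
  posSemidef_sum _ fun _ _ => hM.submatrix _

variable [Fintype X]

open scoped MatrixOrder in
theorem PosSemidef.exists_eq_conjTranspose_mul_self {M : Matrix X X ℂ} (hM : M.PosSemidef) :
    ∃ Q : Matrix X X ℂ, M = Qᴴ * Q := by
  classical
  exact CStarAlgebra.nonneg_iff_eq_star_mul_self.mp hM.nonneg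

theorem trace_partialTraceRight (M : Matrix (X × Y) (X × Y) ℂ) :
    M.partialTraceRight.trace = M.trace := by
  rw [Matrix.partialTraceRight, trace_sum]
  simp only [trace, diag_apply, submatrix_apply,
    Fintype.sum_prod_type]
  exact Finset.sum_comm

open scoped Kronecker in
theorem PosSemidef.weightedPartialTrace {P : Matrix X X ℂ} (hP : P.PosSemidef)
    {M : Matrix (X × Y) (X × Y) ℂ} (hM : M.PosSemidef) :
    (weightedPartialTrace P M).PosSemidef := by
  classical
  obtain ⟨Q, rfl⟩ := hP.exists_eq_conjTranspose_mul_self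
  have hN := hM.mul_mul_conjTranspose_same (Q ⊗ₖ (1 : Matrix Y Y ℂ))
  convert posSemidef_sum (Finset.univ : Finset X) fun k _ => hN.submatrix fun y : Y => (k, y)
  ext y y'
  simp only [Matrix.weightedPartialTrace, of_apply, mul_apply, conjTranspose_apply, sum_apply,
    submatrix_apply, kroneckerMap_apply, one_apply, Fintype.sum_prod_type, mul_ite, ite_mul,
    mul_one, mul_zero, zero_mul, Finset.sum_ite_eq, Finset.mem_univ, if_true, apply_ite star,
    star_zero, Finset.sum_mul]
  rw [Finset.sum_comm_cycle]
  refine Finset.sum_congr rfl fun k _ => ?_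
  refine Finset.sum_congr rfl fun x _ => Finset.sum_congr rfl fun x' _ => ?_
  ring

theorem trace_weightedPartialTrace_vecMulVec (v : X → ℂ) (M : Matrix (X × Y) (X × Y) ℂ) :
    (weightedPartialTrace (vecMulVec v (star v)) M).trace =
      star v ⬝ᵥ M.partialTraceRight *ᵥ v := by
  simp only [trace, diag_apply, weightedPartialTrace, of_apply, vecMulVec_apply, dotProduct,
    mulVec, partialTraceRight, sum_apply, submatrix_apply, Finset.mul_sum, Finset.sum_mul]
  rw [Finset.sum_comm_cycle]
  refine Finset.sum_congr rfl fun x _ => ?_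
  rw [Finset.sum_comm]
  refine Finset.sum_congr rfl fun x' _ => Finset.sum_congr rfl fun y _ => ?_
  ring

theorem re_trace_conjTranspose_mul_self (Q : Matrix Y X ℂ) :
    (Qᴴ * Q).trace.re = ∑ i, ∑ j, ‖Q i j‖ ^ 2 := by
  simp only [trace, diag_apply, mul_apply, conjTranspose_apply, Complex.re_sum]
  rw [Finset.sum_comm]
  refine Finset.sum_congr rfl fun i _ => Finset.sum_congr rfl fun j _ => ?_
  rw [← Complex.normSq_eq_norm_sq, ← Complex.ofReal_re (Complex.normSq _),
    Complex.normSq_eq_conj_mul_self]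
  rfl

attribute [local instance] frobeniusNormedAddCommGroup in
theorem PosSemidef.re_trace_mul_le {A B : Matrix X X ℂ} (hA : A.PosSemidef)
    (hB : B.PosSemidef) : (A * B).trace.re ≤ A.trace.re * B.trace.re := by
  have key (Q : Matrix X X ℂ) : (Qᴴ * Q).trace.re = ‖Q‖ ^ 2 := by
    rw [re_trace_conjTranspose_mul_self, frobenius_norm_def, ← Real.sqrt_eq_rpow,
      Real.sq_sqrt (by positivity)]
    simp
  obtain ⟨P, rfl⟩ := hA.exists_eq_conjTranspose_mul_self
  obtain ⟨Q, rfl⟩ := hB.exists_eq_conjTranspose_mul_self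
  have h : (Pᴴ * P * (Qᴴ * Q)).trace = ((P * Qᴴ)ᴴ * (P * Qᴴ)).trace := by
    rw [conjTranspose_mul, conjTranspose_conjTranspose, ← mul_assoc, trace_mul_comm]
    simp only [mul_assoc]
  rw [h, key, key, key, ← mul_pow, ← frobenius_norm_conjTranspose Q]
  gcongr
  exact frobenius_norm_mul _ _

end Matrix

/-- Gershgorin-type frame bound: if the absolute row sums of the Gram matrix of `v` are at most
`C`, then `C` is an upper frame bound of `v`. -/
theorem sum_norm_inner_sq_le_of_gram {H ι : Type*} [NormedAddCommGroup H] [InnerProductSpace ℂ H]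
    [Fintype ι] [Nonempty ι] (v : ι → H) {C : ℝ} (hC : ∀ a, ∑ b, ‖inner ℂ (v a) (v b)‖ ≤ C) (f : H) :
    ∑ a, ‖inner ℂ (v a) f‖ ^ 2 ≤ C * ‖f‖ ^ 2 := by
  set S := ∑ a, ‖inner ℂ (v a) f‖ ^ 2 with hS
  set u := ∑ a, inner ℂ (v a) f • v a with hu
  have hS0 : 0 ≤ S := by positivity
  have hSu : S ≤ ‖u‖ * ‖f‖ := by
    have h : inner ℂ u f = (S : ℂ) := by
      rw [hu, sum_inner, hS, Complex.ofReal_sum]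
      refine Finset.sum_congr rfl fun a _ => ?_
      rw [inner_smul_left, ← Complex.normSq_eq_conj_mul_self, Complex.normSq_eq_norm_sq]
    calc S = ‖inner ℂ u f‖ := by rw [h, Complex.norm_real, Real.norm_of_nonneg hS0]
      _ ≤ _ := norm_inner_le_norm u f
  have hu2 : ‖u‖ ^ 2 ≤ C * S := by
    have h1 : ‖u‖ ^ 2 ≤ ∑ a, ∑ b,
        ‖inner ℂ (v a) f‖ * ‖inner ℂ (v b) f‖ * ‖inner ℂ (v a) (v b)‖ := by
      have h : ‖u‖ ^ 2 = ‖inner ℂ u u‖ := by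
        rw [inner_self_eq_norm_sq_to_K, norm_pow]; simp
      rw [h]
      nth_rw 1 [hu]
      rw [sum_inner]
      refine (norm_sum_le _ _).trans (Finset.sum_le_sum fun a _ => ?_)
      rw [hu, inner_sum]
      refine (norm_sum_le _ _).trans (Finset.sum_le_sum fun b _ => ?_)
      rw [inner_smul_left, inner_smul_right, norm_mul, norm_mul, RCLike.norm_conj, mul_assoc]
    have h2 : ∑ a, ∑ b, ‖inner ℂ (v a) f‖ * ‖inner ℂ (v b) f‖ * ‖inner ℂ (v a) (v b)‖ ≤
        ∑ a, ∑ b, (‖inner ℂ (v a) f‖ ^ 2 * ‖inner ℂ (v a) (v b)‖ / 2 +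
          ‖inner ℂ (v b) f‖ ^ 2 * ‖inner ℂ (v b) (v a)‖ / 2) := by
      refine Finset.sum_le_sum fun a _ => Finset.sum_le_sum fun b _ => ?_
      rw [norm_inner_symm (v b) (v a)]
      nlinarith [mul_nonneg (sq_nonneg (‖inner ℂ (v a) f‖ - ‖inner ℂ (v b) f‖))
        (norm_nonneg (inner ℂ (v a) (v b)))]
    have h3 : ∑ a, ∑ b, ‖inner ℂ (v a) f‖ ^ 2 * ‖inner ℂ (v a) (v b)‖ / 2 ≤ C * S / 2 := by
      rw [hS, Finset.mul_sum, Finset.sum_div]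
      refine Finset.sum_le_sum fun a _ => ?_
      rw [← Finset.sum_div, ← Finset.mul_sum, mul_comm C]
      gcongr
      exact hC a
    simp only [Finset.sum_add_distrib] at h2
    rw [Finset.sum_comm (f := fun a b => ‖inner ℂ (v b) f‖ ^ 2 * ‖inner ℂ (v b) (v a)‖ / 2)] at h2
    linarith
  rcases hS0.eq_or_lt with h | h
  · rw [← h]
    have : 0 ≤ C := (Finset.sum_nonneg fun _ _ => norm_nonneg _).trans (hC (Classical.arbitrary ι))
    positivity
  · refine le_of_mul_le_mul_left ?_ h
    calc S * S ≤ (‖u‖ * ‖f‖) * (‖u‖ * ‖f‖) := by gcongr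
      _ = ‖u‖ ^ 2 * ‖f‖ ^ 2 := by ring
      _ ≤ C * S * ‖f‖ ^ 2 := by gcongr
      _ = S * (C * ‖f‖ ^ 2) := by ring

open Matrix

theorem Matrix.PosSemidef.sum_re_dotProduct_mulVec_le {X ι : Type*} [Fintype X] [Fintype ι]
    [Nonempty ι] {M : Matrix X X ℂ} (hM : M.PosSemidef) (v : ι → X → ℂ) {C : ℝ}
    (hC : ∀ a, ∑ b, ‖star (v a) ⬝ᵥ v b‖ ≤ C) :
    ∑ a, (star (v a) ⬝ᵥ M *ᵥ v a).re ≤ C * M.trace.re := by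
  obtain ⟨Q, rfl⟩ := hM.exists_eq_conjTranspose_mul_self
  have hinner (x y : X → ℂ) : inner ℂ (WithLp.toLp 2 x) (WithLp.toLp 2 y) = star x ⬝ᵥ y := by
    rw [EuclideanSpace.inner_toLp_toLp, dotProduct_comm]
  have hquad (a : ι) : (star (v a) ⬝ᵥ (Qᴴ * Q) *ᵥ v a).re =
      ∑ k, ‖inner ℂ (WithLp.toLp 2 (v a)) (WithLp.toLp 2 (star (Q k)))‖ ^ 2 := by
    rw [← mulVec_mulVec, dotProduct_mulVec, ← star_mulVec, dotProduct, Complex.re_sum]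
    refine Finset.sum_congr rfl fun k _ => ?_
    rw [hinner, star_dotProduct_star, norm_star, ← Complex.normSq_eq_norm_sq,
      ← Complex.ofReal_re (Complex.normSq _), Complex.normSq_eq_conj_mul_self]
    rfl
  simp only [hquad]
  rw [Finset.sum_comm, re_trace_conjTranspose_mul_self, Finset.mul_sum]
  refine Finset.sum_le_sum fun k _ => ?_
  refine (sum_norm_inner_sq_le_of_gram (fun a => WithLp.toLp 2 (v a)) (C := C)
    (by simpa only [hinner] using hC) _).trans_eq ?_
  rw [EuclideanSpace.norm_sq_eq]
  simp

theorem MutuallyUnbiasedBases.sum_norm_dotProduct_le {d : ℕ} {e : Fin (d + 1) → Fin d → Fin d → ℂ}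
    (he : MutuallyUnbiasedBases e) (x : Fin (d + 1) → Fin d) (a : Fin (d + 1)) :
    ∑ b, ‖star (e a (x a)) ⬝ᵥ e b (x b)‖ ≤ 1 + √d := by
  rw [← Finset.add_sum_erase _ _ (Finset.mem_univ a)]
  have h1 : ‖star (e a (x a)) ⬝ᵥ e a (x a)‖ = 1 := by
    have := he.1 a (x a) (x a)
    rw [if_pos rfl] at this
    exact (congrArg norm this).trans norm_one
  have h2 : ∀ b ∈ Finset.univ.erase a, ‖star (e a (x a)) ⬝ᵥ e b (x b)‖ = √(1 / d) := by
    intro b hb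
    rw [← he.2 a b (Finset.ne_of_mem_erase hb).symm (x a) (x b), Real.sqrt_sq (norm_nonneg _)]
    rfl
  rw [h1, Finset.sum_congr rfl h2, Finset.sum_const, Finset.card_erase_of_mem (Finset.mem_univ a)]
  simp [← div_eq_mul_inv]

theorem sum_pair_comm {I J K L : Type*} [Fintype I] [Fintype J] [Fintype K] [Fintype L]
    (f : I → J → K → L → ℂ) :
    ∑ i, ∑ j, ∑ k, ∑ l, f i j k l = ∑ k, ∑ l, ∑ i, ∑ j, f i j k l := by
  simpa only [Fintype.sum_prod_type] using
    Finset.sum_comm (s := (Finset.univ : Finset (I × J))) (t := (Finset.univ : Finset (K × L)))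
      (f := fun p q => f p.1 p.2 q.1 q.2)

theorem corrProb_rhoMUB {d : ℕ} (e : Fin (d + 1) → Fin d → Fin d → ℂ) (x : Fin d)
    {A' B' : Type*} [Fintype A'] [Fintype B']
    (E : Matrix (Fin (d + 1) × A') (Fin (d + 1) × A') ℂ) (F : Matrix (Fin d × B') (Fin d × B') ℂ)
    (η : Matrix (A' × B') (A' × B') ℂ) :
    corrProb E F (rhoMUB d e x) η = (1 / ((d : ℂ) + 1)) *
      ∑ a, (weightedPartialTrace (vecMulVec (e a x) (star (e a x))) F *
        weightedPartialTrace (E.submatrix (Prod.mk a) (Prod.mk a)) η).trace := by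
  rw [Finset.mul_sum, corrProb]
  refine Finset.sum_congr rfl fun a _ => ?_
  rw [Finset.sum_eq_single a (fun a₁ _ h => by simp [rhoMUB, h]) (by simp)]
  simp only [rhoMUB, of_apply, if_true, trace, diag_apply, mul_apply, weightedPartialTrace,
    submatrix_apply, vecMulVec_apply, Pi.star_apply]
  simp only [sum_pair_comm (I := A')]
  rw [sum_pair_comm, Finset.mul_sum]
  refine Finset.sum_congr rfl fun b' _ => ?_
  rw [Finset.mul_sum]
  refine Finset.sum_congr rfl fun b₁' _ => ?_
  rw [Finset.sum_comm]
  simp only [Finset.sum_mul]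
  simp only [Finset.mul_sum]
  refine Finset.sum_congr rfl fun b₁ _ => Finset.sum_congr rfl fun b _ => ?_
  refine Finset.sum_congr rfl fun a' _ => Finset.sum_congr rfl fun a₁' _ => ?_
  simp only [starRingEnd_apply]
  ring

theorem IsPOVM.sum_trace_weightedPartialTrace {ι A A' B' : Type*} [Fintype ι] [Fintype A]
    [DecidableEq A] [Fintype A'] [DecidableEq A'] [Fintype B']
    {E : ι → Matrix (A × A') (A × A') ℂ} (hE : IsPOVM E) (η : Matrix (A' × B') (A' × B') ℂ)
    (a : A) :
    ∑ i, (weightedPartialTrace ((E i).submatrix (Prod.mk a) (Prod.mk a)) η).trace = η.trace := by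
  have hsum (x x' : A') : ∑ i, E i (a, x) (a, x') = if x = x' then 1 else 0 := by
    rw [← Matrix.sum_apply, hE.2, one_apply]
    simp
  simp only [trace, diag_apply, weightedPartialTrace, of_apply, submatrix_apply,
    Fintype.sum_prod_type]
  rw [Finset.sum_comm, Finset.sum_comm (s := (Finset.univ : Finset A'))]
  refine Finset.sum_congr rfl fun y _ => ?_
  rw [Finset.sum_comm]
  refine Finset.sum_congr rfl fun x _ => ?_
  rw [Finset.sum_comm]
  simp [← Finset.sum_mul, hsum]

/-- **Upper bound on the success probability of instantaneously guessing `x`.**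
For `d + 1` mutually unbiased bases `{|e^a_x⟩}` of `ℂ^d` and the states
`ρ^x = (1/(d+1)) ∑ a, |a⟩⟨a| ⊗ |e^a_x⟩⟨e^a_x|` given with uniform prior `1/d`, any
instantaneous strategy — shared entangled state `η` on `A' ⊗ B'`, local POVMs `{E^α}` on
`A ⊗ A'` and `{F^β}` on `B ⊗ B'`, and post-processing `g` — guesses `x` with probability
`p_succ = (1/d) ∑_x ∑_{(α,β) : g(α,β)=x} tr[(E^α ⊗ F^β)(ρ^x ⊗ η)] ≤ 2 dim(B')/√d`. -/
theorem success_prob_bound (d : ℕ) (hd : 2 ≤ d)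
    (e : Fin (d + 1) → Fin d → Fin d → ℂ) (he : MutuallyUnbiasedBases e)
    (dA' dB' : ℕ)
    (η : Matrix (Fin dA' × Fin dB') (Fin dA' × Fin dB') ℂ)
    (hη : η.PosSemidef) (hη1 : η.trace = 1)
    (nI nJ : ℕ)
    (E : Fin nI → Matrix (Fin (d + 1) × Fin dA') (Fin (d + 1) × Fin dA') ℂ)
    (hE : IsPOVM E)
    (F : Fin nJ → Matrix (Fin d × Fin dB') (Fin d × Fin dB') ℂ)
    (hF : IsPOVM F)
    (g : Fin nI → Fin nJ → Fin d) :
    ((1 / (d : ℂ)) * ∑ x : Fin d, ∑ α, ∑ β,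
        if g α β = x then corrProb (E α) (F β) (rhoMUB d e x) η else 0).re ≤
      2 * (dB' : ℝ) / Real.sqrt d := by
  have hd0 : (0 : ℝ) < d := by exact_mod_cast (by omega : 0 < d)
  rcases Nat.eq_zero_or_pos nI with rfl | hnI
  · simp only [Finset.univ_eq_empty, Finset.sum_empty, Finset.sum_const_zero, mul_zero,
      Complex.zero_re]
    positivity
  have : Nonempty (Fin nI) := ⟨⟨0, hnI⟩⟩
  let G (a : Fin (d + 1)) (x : Fin d) (β : Fin nJ) :=
    weightedPartialTrace (vecMulVec (e a x) (star (e a x))) (F β)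
  let σ (a : Fin (d + 1)) (α : Fin nI) :=
    weightedPartialTrace ((E α).submatrix (Prod.mk a) (Prod.mk a)) η
  let h (a : Fin (d + 1)) (α : Fin nI) : ℝ := ∑ β, (G a (g α β) β).trace.re
  have hG (a x β) : (G a x β).PosSemidef :=
    (posSemidef_vecMulVec_self_star _).weightedPartialTrace (hF.1 β)
  have hσ (a α) : (σ a α).PosSemidef := ((hE.1 α).submatrix _).weightedPartialTrace hη
  have hσ_sum (a) : ∑ α, (σ a α).trace.re = 1 := by
    rw [← Complex.re_sum, hE.sum_trace_weightedPartialTrace η a, hη1, Complex.one_re]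
  choose m hm using fun a => Finite.exists_max (h a)
  have hF_trace : ∑ β, (F β).trace.re = d * dB' := by
    rw [← Complex.re_sum, ← trace_sum, hF.2, trace_one]
    simp
  have hsum : ∑ a, h a (m a) ≤ (1 + √d) * (d * dB') := by
    rw [← hF_trace, Finset.mul_sum, Finset.sum_comm]
    refine Finset.sum_le_sum fun β _ => ?_
    simp only [G, trace_weightedPartialTrace_vecMulVec]
    rw [← trace_partialTraceRight]
    exact (hF.1 β).partialTraceRight.sum_re_dotProduct_mulVec_le (fun a => e a (g (m a) β))
      (he.sum_norm_dotProduct_le fun a => g (m a) β)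
  have hsucc : ((1 / (d : ℂ)) * ∑ x : Fin d, ∑ α, ∑ β,
        if g α β = x then corrProb (E α) (F β) (rhoMUB d e x) η else 0).re =
      1 / d * (1 / (d + 1)) * ∑ a, ∑ α, ∑ β, (G a (g α β) β * σ a α).trace.re := by
    rw [Finset.sum_comm]
    simp only [Finset.sum_comm (s := (Finset.univ : Finset (Fin d))), Finset.sum_ite_eq,
      Finset.mem_univ, if_true, corrProb_rhoMUB, ← Finset.mul_sum]
    rw [← mul_assoc, Finset.sum_comm_cycle]
    have hc : (1 / (d : ℂ)) * (1 / ((d : ℂ) + 1)) = ((1 / d * (1 / (d + 1)) : ℝ) : ℂ) := by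
      push_cast; rfl
    rw [hc, Complex.re_ofReal_mul]
    simp only [Complex.re_sum, G, σ]
  rw [hsucc]
  have hbound : ∑ a, ∑ α, ∑ β, (G a (g α β) β * σ a α).trace.re ≤ ∑ a, h a (m a) := by
    refine Finset.sum_le_sum fun a _ => ?_
    calc ∑ α, ∑ β, (G a (g α β) β * σ a α).trace.re
        ≤ ∑ α, h a α * (σ a α).trace.re := by
          refine Finset.sum_le_sum fun α _ => ?_
          rw [Finset.sum_mul]
          exact Finset.sum_le_sum fun β _ => (hG ..).re_trace_mul_le (hσ ..)
      _ ≤ ∑ α, h a (m a) * (σ a α).trace.re := by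
          refine Finset.sum_le_sum fun α _ => ?_
          exact mul_le_mul_of_nonneg_right (hm a α) (Complex.le_def.mp (hσ a α).trace_nonneg).1
      _ = h a (m a) := by rw [← Finset.mul_sum, hσ_sum, mul_one]
  have hsqrt : 0 < √(d : ℝ) := Real.sqrt_pos.mpr hd0
  calc 1 / (d : ℝ) * (1 / (d + 1)) * ∑ a, ∑ α, ∑ β, (G a (g α β) β * σ a α).trace.re
      ≤ 1 / (d : ℝ) * (1 / (d + 1)) * ((1 + √d) * (d * dB')) := by
        gcongr
        exact hbound.trans hsum
    _ = (1 + √d) / (d + 1) * dB' := by field_simp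
    _ ≤ 2 / √d * dB' := by
        refine mul_le_mul_of_nonneg_right ?_ (Nat.cast_nonneg _)
        rw [div_le_div_iff₀ (by positivity) hsqrt]
        nlinarith [Real.sq_sqrt hd0.le, sq_nonneg (√(d : ℝ) - 1)]
    _ = 2 * dB' / √d := by ring
end

section
/- Let d ≥ 2 and let {|e^a_x⟩}_{x=1}^d for a = 0,…,d be d+1 pairwise mutually unbiased orthonormal bases of ℂ^d. Let I be a finite set, let w: {0,…,d}×I → ℝ_{≥0} satisfy Σ_{α∈I} w(a,α) = 1 for every a, and let f: {0,…,d}×I → {1,…,d} be any function. Then the operator norm of the positive semidefinite operator Σ_{a=0}^d Σ_{α∈I} w(a,α) |e^a_{f(a,α)}⟩⟨e^a_{f(a,α)}| on ℂ^d is at most (d+2)/√d + 1. -/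
open scoped ComplexOrder

/-- The operator norm (largest singular value) of a matrix, i.e. the norm of the induced
linear map between Euclidean spaces. -/
noncomputable def opNorm {m n : Type*} [Fintype m] [Fintype n] [DecidableEq n]
    (M : Matrix m n ℂ) : ℝ :=
  ‖LinearMap.toContinuousLinearMap (Matrix.toEuclideanLin M)‖

open Matrix in
/-- The operator norm is bounded by the Hilbert–Schmidt norm. -/
theorem opNorm_le_sqrt_trace {m n : Type*} [Fintype m] [Fintype n] [DecidableEq n]
    (A : Matrix m n ℂ) : opNorm A ≤ Real.sqrt (Aᴴ * A).trace.re := by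
  have trace_eq : (Aᴴ * A).trace.re = ∑ i, ∑ j, ‖A i j‖ ^ 2 := by
    rw [Finset.sum_comm]
    simp [Matrix.trace, Matrix.mul_apply, ← Complex.normSq_eq_norm_sq, Complex.normSq_apply]
  refine ContinuousLinearMap.opNorm_le_bound _ (Real.sqrt_nonneg _) fun x => ?_
  rw [trace_eq, EuclideanSpace.norm_eq, EuclideanSpace.norm_eq,
    ← Real.sqrt_mul (by positivity), Finset.sum_mul]
  refine Real.sqrt_le_sqrt (Finset.sum_le_sum fun i _ => ?_)
  calc ‖∑ j, A i j * x j‖ ^ 2 ≤ (∑ j, ‖A i j‖ * ‖x j‖) ^ 2 := by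
        gcongr
        exact (norm_sum_le _ _).trans_eq (by simp)
    _ ≤ _ := Finset.sum_mul_sq_le_sq_mul_sq _ _ _

theorem opNorm_add_le {m n : Type*} [Fintype m] [Fintype n] [DecidableEq n]
    (A B : Matrix m n ℂ) : opNorm (A + B) ≤ opNorm A + opNorm B := by
  simpa [opNorm] using norm_add_le (LinearMap.toContinuousLinearMap (Matrix.toEuclideanLin A))
    (LinearMap.toContinuousLinearMap (Matrix.toEuclideanLin B))

theorem opNorm_smul_one_le {n : Type*} [Fintype n] [DecidableEq n] {c : ℝ} (hc : 0 ≤ c) :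
    opNorm ((c : ℂ) • (1 : Matrix n n ℂ)) ≤ c := by
  refine ContinuousLinearMap.opNorm_le_bound _ hc fun x => ?_
  rw [map_smul, LinearMap.coe_toContinuousLinearMap', LinearMap.smul_apply, norm_smul]
  simp [abs_of_nonneg hc]

open Matrix in
theorem trace_vecMulVec_star_mul_vecMulVec_star {n : Type*} [Fintype n] (u v : n → ℂ) :
    (vecMulVec u (star u) * vecMulVec v (star v)).trace =
      ((‖∑ i, (starRingEnd ℂ) (u i) * v i‖ ^ 2 : ℝ) : ℂ) := by
  rw [vecMulVec_mul_vecMulVec, trace_vecMulVec, dotProduct_smul, Complex.ofReal_pow,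
    ← Complex.mul_conj', dotProduct, dotProduct, smul_eq_mul, map_sum]
  simp [mul_comm]

open Matrix in
/-- Centering a Hermitian matrix by a multiple of the identity: the squared Hilbert–Schmidt norm. -/
theorem trace_sub_smul_one_sq {n : Type*} [Fintype n] [DecidableEq n] {M : Matrix n n ℂ}
    (hM : M.IsHermitian) (c : ℝ) :
    ((M - (c : ℂ) • (1 : Matrix n n ℂ))ᴴ * (M - (c : ℂ) • 1)).trace.re =
      (M * M).trace.re - 2 * c * M.trace.re + c ^ 2 * Fintype.card n := by
  simp [hM.eq, sub_mul, mul_sub]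
  ring

section MutuallyUnbiased

variable {d : ℕ} {ι I : Type*} [Fintype ι] [Fintype I] {e : ι → Fin d → Fin d → ℂ}
  {w : ι → I → ℝ}

open Matrix in
theorem isHermitian_weighted_projectors (e : ι → Fin d → Fin d → ℂ) (w : ι → I → ℝ)
    (f : ι → I → Fin d) :
    (∑ a, ∑ α, (w a α : ℂ) •
      vecMulVec (e a (f a α)) (star (e a (f a α)))).IsHermitian := by
  simp [Matrix.IsHermitian, conjTranspose_sum, conjTranspose_vecMulVec]

open Matrix in
theorem trace_weighted_projectors (he : ∀ a, IsONB (e a)) (hw1 : ∀ a, ∑ α, w a α = 1)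
    (f : ι → I → Fin d) :
    (∑ a, ∑ α, (w a α : ℂ) • vecMulVec (e a (f a α)) (star (e a (f a α)))).trace =
      Fintype.card ι := by
  have unit (a α) : e a (f a α) ⬝ᵥ star (e a (f a α)) = 1 := by
    simpa [dotProduct, mul_comm] using he a (f a α) (f a α)
  simp only [trace_sum, trace_smul, trace_vecMulVec, unit, smul_eq_mul, mul_one,
    ← Complex.ofReal_sum, hw1]
  simp

open Matrix in
theorem trace_sq_weighted_projectors_le (he : MutuallyUnbiasedBases e) (hw : ∀ a α, 0 ≤ w a α)
    (hw1 : ∀ a, ∑ α, w a α = 1) (f : ι → I → Fin d) :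
    ((∑ a, ∑ α, (w a α : ℂ) • vecMulVec (e a (f a α)) (star (e a (f a α)))) *
      (∑ a, ∑ α, (w a α : ℂ) • vecMulVec (e a (f a α)) (star (e a (f a α))))).trace.re ≤
      Fintype.card ι * (1 + (Fintype.card ι - 1) / d) := by
  classical
  have overlap (a b x y) : ‖∑ i, (starRingEnd ℂ) (e a x i) * e b y i‖ ^ 2 ≤
      1 / (d : ℝ) + if a = b then 1 - 1 / (d : ℝ) else 0 := by
    split_ifs with hab
    · subst hab
      rw [he.1 a x y]
      split_ifs <;> simp
    · rw [he.2 a b hab x y, add_zero]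
  calc _ = ∑ a, ∑ b, ∑ α, ∑ β, w a α * w b β *
        ‖∑ i, (starRingEnd ℂ) (e a (f a α) i) * e b (f b β) i‖ ^ 2 := by
        simp only [Finset.sum_mul, Finset.mul_sum, smul_mul_smul_comm, trace_sum, trace_smul,
          trace_vecMulVec_star_mul_vecMulVec_star, smul_eq_mul, ← Complex.ofReal_mul,
          ← Complex.ofReal_sum, Complex.ofReal_re]
        rw [Finset.sum_congr rfl fun b _ => Finset.sum_comm, Finset.sum_comm]
        exact Finset.sum_congr rfl fun a _ => Finset.sum_congr rfl fun b _ => Finset.sum_comm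
    _ ≤ ∑ a, ∑ b, ∑ α, ∑ β, w a α * w b β *
        (1 / (d : ℝ) + if a = b then 1 - 1 / (d : ℝ) else 0) := by
        gcongr with a _ b _ α _ β _
        · exact mul_nonneg (hw a α) (hw b β)
        · exact overlap a b _ _
    _ = ∑ a : ι, ∑ b : ι, (1 / (d : ℝ) + if a = b then 1 - 1 / (d : ℝ) else 0) := by
        simp only [← Finset.sum_mul, ← Finset.mul_sum, hw1, one_mul]
    _ = _ := by
        simp [Finset.sum_add_distrib]
        ring

end MutuallyUnbiased

/-- **Operator-norm bound for mixtures of mutually unbiased projectors.**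
Given `d + 1` mutually unbiased bases `{|e^a_x⟩}` of `ℂ^d`, nonnegative weights `w` with
`∑ α, w a α = 1` for every `a`, and any selection function `f`, the operator
`∑_{a,α} w(a,α) |e^a_{f(a,α)}⟩⟨e^a_{f(a,α)}|` has operator norm at most `(d+2)/√d + 1`. -/
theorem mub_weighted_projectors_opNorm_bound (d : ℕ) (hd : 2 ≤ d)
    (e : Fin (d + 1) → Fin d → Fin d → ℂ) (he : MutuallyUnbiasedBases e)
    {I : Type*} [Fintype I] (w : Fin (d + 1) → I → ℝ) (hw : ∀ a α, 0 ≤ w a α)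
    (hw1 : ∀ a, ∑ α, w a α = 1) (f : Fin (d + 1) → I → Fin d) :
    opNorm (∑ a, ∑ α, (w a α : ℂ) •
        Matrix.vecMulVec (e a (f a α)) (star (e a (f a α)))) ≤
      ((d : ℝ) + 2) / Real.sqrt d + 1 := by
  have hd0 : (0 : ℝ) < d := by positivity
  set M := ∑ a, ∑ α, (w a α : ℂ) • Matrix.vecMulVec (e a (f a α)) (star (e a (f a α))) with hM
  set c : ℝ := ((d : ℝ) + 1) / d with hc
  have hs : (M * M).trace.re ≤ 2 * (d + 1) := by
    refine (trace_sq_weighted_projectors_le he hw hw1 f).trans_eq ?_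
    simp [hd0.ne']
    ring
  have ht : M.trace.re = d + 1 := by
    rw [hM, trace_weighted_projectors he.1 hw1 f]
    simp
  have hF : ((M - (c : ℂ) • 1).conjTranspose * (M - (c : ℂ) • 1)).trace.re ≤ d := by
    rw [trace_sub_smul_one_sq (isHermitian_weighted_projectors e w f), ht, Fintype.card_fin]
    have : 2 * c * (d + 1) - c ^ 2 * d = d + 2 + 1 / d := by
      rw [hc]
      field_simp
      ring
    have : 0 < 1 / (d : ℝ) := by positivity
    linarith
  have h1d : (1 : ℝ) ≤ d := by exact_mod_cast (by lia : 1 ≤ d)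
  calc opNorm M = opNorm ((M - (c : ℂ) • 1) + (c : ℂ) • 1) := by rw [sub_add_cancel]
    _ ≤ √d + c := (opNorm_add_le _ _).trans (add_le_add
        ((opNorm_le_sqrt_trace _).trans (Real.sqrt_le_sqrt hF))
        (opNorm_smul_one_le (by positivity)))
    _ ≤ ((d : ℝ) + 2) / √d + 1 := by
        have h1 : ((d : ℝ) + 2) / √d = √d + 2 / √d := by
          rw [add_div, Real.div_sqrt]
        have h2 : 1 / (d : ℝ) ≤ 2 / √d :=
          div_le_div₀ (by norm_num) (by norm_num) (by positivity)
            (Real.sqrt_le_self_iff.2 (.inr h1d))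
        rw [h1, hc, add_div, div_self hd0.ne']
        linarith
end

section
/- Equivalence of port-based teleportation with state discrimination: Let d, N ≥ 1, let A ≅ ℂ^d, A'^N = (ℂ^d)^{⊗N}, and for i = 1,…,N define the density matrix η^i on A⊗A'^N by η^i = |Φ_d⟩⟨Φ_d|_{A'_i A} ⊗ ⨂_{j≠i}(I_d/d)_{A'_j} (the maximally entangled state between the i-th auxiliary factor and A, tensored with maximally mixed states on the other auxiliary factors). Then for every POVM {E^i}_{i=1}^N on A⊗A'^N, the port-based teleportation channel ℰ associated with this POVM has entanglement fidelity F(ℰ) = (1/d²) Σ_{i=1}^N tr(E^i η^i) = (N/d²)·p_succ, where p_succ = (1/N)Σ_{i=1}^N tr(E^i η^i) is the average success probability of distinguishing the states {η^i}_{i=1}^N (with uniform prior) using the POVM {E^i}. -/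
open scoped ComplexOrder

/-- The state `η^i = |Φ_d⟩⟨Φ_d|_{A'_i A} ⊗ ⨂_{j ≠ i} (I_d/d)_{A'_j}` on `A ⊗ A'^N`
(indexed by `Fin d × (Fin N → Fin d)`, the first factor being `A`). -/
noncomputable def etaPBT (d N : ℕ) (i : Fin N) :
    Matrix (Fin d × (Fin N → Fin d)) (Fin d × (Fin N → Fin d)) ℂ :=
  Matrix.of fun p q =>
    if p.1 = p.2 i ∧ q.1 = q.2 i ∧ ∀ j, j ≠ i → p.2 j = q.2 j then 1 / (d : ℂ) ^ N else 0

/-- Resampling one coordinate and forgetting its old value counts every function once for each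
old value. -/
theorem sum_sum_update {ι κ M : Type*} [Fintype ι] [DecidableEq ι] [Fintype κ]
    [AddCommMonoid M] (i : ι) (g : (ι → κ) → M) :
    ∑ h : ι → κ, ∑ x, g (Function.update h i x) = Fintype.card κ • ∑ p, g p := by
  have key : ∑ z : (ι → κ) × κ, g (Function.update z.1 i z.2) = ∑ z : (ι → κ) × κ, g z.1 :=
    Fintype.sum_equiv
      { toFun := fun z => (Function.update z.1 i z.2, z.1 i)
        invFun := fun z => (Function.update z.1 i z.2, z.1 i)
        left_inv := fun z => by simp
        right_inv := fun z => by simp } _ _ fun _ => rfl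
  rw [Fintype.sum_prod_type, Fintype.sum_prod_type] at key
  simpa [Finset.smul_sum] using key

/-- Summing over the functions that agree with `p` away from `i` amounts to summing over the
value at `i`. -/
theorem sum_ite_agree_off {ι κ M : Type*} [Fintype ι] [DecidableEq ι] [Fintype κ]
    [DecidableEq κ] [AddCommMonoid M] (i : ι) (p : ι → κ) (g : (ι → κ) → M) :
    (∑ q, if ∀ j, j ≠ i → q j = p j then g q else 0) = ∑ y, g (Function.update p i y) := by
  rw [← Finset.sum_filter]
  symm
  refine Finset.sum_bij' (fun y _ => Function.update p i y) (fun q _ => q i) ?_ ?_ ?_ ?_ ?_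
  · intro y _
    simp +contextual
  · simp
  · simp
  · intro q hq
    ext j
    by_cases hj : j = i
    · subst hj; simp
    · simpa [hj] using ((Finset.mem_filter.mp hq).2 j hj).symm
  · simp

/-- The trace against `η^i`, as a sum over pairs of indices that agree away from port `i`. -/
theorem trace_mul_etaPBT (d N : ℕ) (i : Fin N)
    (E : Matrix (Fin d × (Fin N → Fin d)) (Fin d × (Fin N → Fin d)) ℂ) :
    (E * etaPBT d N i).trace = (1 / (d : ℂ) ^ N) * ∑ p : Fin N → Fin d, ∑ y,
      E (p i, p) (y, Function.update p i y) := by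
  have inner (a : Fin d) (p : Fin N → Fin d) :
      ∑ q, E (a, p) q * etaPBT d N i q (a, p) =
        if a = p i then (1 / (d : ℂ) ^ N) * ∑ y, E (a, p) (y, Function.update p i y) else 0 := by
    have h := sum_ite_agree_off i p fun q => E (a, p) (q i, q)
    simp only [Function.update_self] at h
    rw [← h, Fintype.sum_prod_type, Finset.sum_comm, Finset.mul_sum]
    by_cases ha : a = p i <;> simp [etaPBT, ha, ite_and, mul_comm]
  simp only [Matrix.trace, Matrix.diag_apply, Matrix.mul_apply]
  rw [Fintype.sum_prod_type, Finset.sum_comm]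
  simp [inner, Finset.mul_sum]

/-- The trace defining the entanglement fidelity, in terms of the matrix units. -/
theorem trace_maxEnt_mul_tensorId (d : ℕ)
    (Ch : Matrix (Fin d) (Fin d) ℂ → Matrix (Fin d) (Fin d) ℂ) :
    (maxEnt d * tensorId Ch (Fin d) (maxEnt d)).trace =
      (1 / (d : ℂ)) * ∑ x, ∑ y, Ch (Matrix.single y x (1 / (d : ℂ))) y x := by
  have unit (x y : Fin d) :
      (Matrix.of fun a a' => maxEnt d (a, y) (a', x)) = Matrix.single y x (1 / (d : ℂ)) := by
    ext a a'
    simp [maxEnt, Matrix.single_apply, eq_comm]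
  simp only [Matrix.trace, Matrix.diag_apply, Matrix.mul_apply, tensorId, Matrix.of_apply, unit]
  simp [Fintype.sum_prod_type, maxEnt, ite_and, Finset.mul_sum]

/-- The port-based teleportation channel on a matrix unit. -/
theorem pbtChannel_single (d N : ℕ)
    (E : Fin N → Matrix (Fin d × (Fin N → Fin d)) (Fin d × (Fin N → Fin d)) ℂ)
    (x y : Fin d) (c : ℂ) :
    pbtChannel d N E (Matrix.single y x c) y x =
      (1 / (d : ℂ) ^ (N + 1)) * ∑ i, ∑ h : Fin N → Fin d,
        E i (x, Function.update h i x) (y, Function.update h i y) * c := by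
  simp [pbtChannel, Matrix.single_apply, ite_and]

/-- Complex form of the fidelity formula. -/
theorem trace_maxEnt_pbtChannel (d N : ℕ) (hd : d ≠ 0)
    (E : Fin N → Matrix (Fin d × (Fin N → Fin d)) (Fin d × (Fin N → Fin d)) ℂ) :
    (maxEnt d * tensorId (pbtChannel d N E) (Fin d) (maxEnt d)).trace =
      (1 / (d : ℂ) ^ 2) * ∑ i, (E i * etaPBT d N i).trace := by
  have hd' : (d : ℂ) ≠ 0 := Nat.cast_ne_zero.mpr hd
  have resample (i : Fin N) :
      ∑ x, ∑ y, ∑ h : Fin N → Fin d,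
        E i (x, Function.update h i x) (y, Function.update h i y) =
      d * ∑ p : Fin N → Fin d, ∑ y, E i (p i, p) (y, Function.update p i y) := by
    have h := sum_sum_update i fun p : Fin N → Fin d =>
      ∑ y, E i (p i, p) (y, Function.update p i y)
    simp only [Function.update_self, Function.update_idem, Fintype.card_fin,
      nsmul_eq_mul] at h
    rw [← h]
    refine Eq.trans ?_ Finset.sum_comm
    exact Finset.sum_congr rfl fun x _ => Finset.sum_comm
  have collect :
      ∑ x, ∑ y, pbtChannel d N E (Matrix.single y x (1 / (d : ℂ))) y x =
        (1 / (d : ℂ) ^ (N + 1)) * ((∑ i, ∑ x, ∑ y, ∑ h : Fin N → Fin d,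
          E i (x, Function.update h i x) (y, Function.update h i y)) * (1 / (d : ℂ))) := by
    simp only [pbtChannel_single, ← Finset.mul_sum, ← Finset.sum_mul]
    congr 2
    rw [Finset.sum_comm]
    refine (Finset.sum_congr rfl fun y _ => Finset.sum_comm).trans ?_
    rw [Finset.sum_comm]
    exact Finset.sum_congr rfl fun i _ => Finset.sum_comm
  rw [trace_maxEnt_mul_tensorId, collect]
  simp only [resample, trace_mul_etaPBT, ← Finset.mul_sum]
  field_simp
  ring

/-- **Equivalence of port-based teleportation with state discrimination**
(Ishizaka–Hiroshima).  For every POVM `{E^i}_{i=1}^N` on `A ⊗ A'^N`, the entanglement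
fidelity of the associated port-based teleportation channel equals
`(1/d²) ∑ i, tr(E^i η^i) = (N/d²) p_succ`, where
`p_succ = (1/N) ∑ i, tr(E^i η^i)` is the average success probability of distinguishing the
states `{η^i}` (with uniform prior) using the POVM `{E^i}`. -/
theorem pbt_fidelity_eq_discrimination (d N : ℕ) (hd : 1 ≤ d) (hN : 1 ≤ N)
    (E : Fin N → Matrix (Fin d × (Fin N → Fin d)) (Fin d × (Fin N → Fin d)) ℂ)
    (hE : IsPOVM E) :
    entFidelity d (pbtChannel d N E) =
      (1 / (d : ℝ) ^ 2) * ∑ i, ((E i * etaPBT d N i).trace).re ∧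
    entFidelity d (pbtChannel d N E) =
      ((N : ℝ) / (d : ℝ) ^ 2) * ((1 / (N : ℝ)) * ∑ i, ((E i * etaPBT d N i).trace).re) := by
  have fidelity : entFidelity d (pbtChannel d N E) =
      (1 / (d : ℝ) ^ 2) * ∑ i, ((E i * etaPBT d N i).trace).re := by
    have scalar : (1 / (d : ℂ) ^ 2) = ((1 / (d : ℝ) ^ 2 : ℝ) : ℂ) := by push_cast; rfl
    rw [entFidelity, trace_maxEnt_pbtChannel d N (by omega) E, scalar, Complex.re_ofReal_mul,
      Complex.re_sum]
  have hN' : (N : ℝ) ≠ 0 := Nat.cast_ne_zero.mpr (by omega)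
  refine ⟨fidelity, fidelity.trans ?_⟩
  field_simp
end

section
/- Discrimination of the port-based teleportation ensemble: Let d, N ≥ 1, let A ≅ ℂ^d, A'^N = (ℂ^d)^{⊗N}, and for i = 1,…,N let η^i = |Φ_d⟩⟨Φ_d|_{A'_i A} ⊗ ⨂_{j≠i}(I_d/d)_{A'_j} on A⊗A'^N. Then there exists a POVM {E^i}_{i=1}^N on A⊗A'^N whose average success probability of distinguishing the states {η^i}_{i=1}^N with uniform prior satisfies (1/N) Σ_{i=1}^N tr(E^i η^i) ≥ (d²/N)·(1 − (d²−1)/N). -/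
open scoped ComplexOrder

/-- Interpolation between the `ℓ¹`, `ℓ²` and `ℓ⁴` norms of a nonnegative vector. -/
lemma sum_sq_pow_three_le {ι : Type*} [Fintype ι] (x : ι → ℝ) (hx : ∀ i, 0 ≤ x i) :
    (∑ i, x i ^ 2) ^ 3 ≤ (∑ i, x i) ^ 2 * ∑ i, x i ^ 4 := by
  have h₁ : (∑ i, x i ^ 2) ^ 2 ≤ (∑ i, x i) * ∑ i, x i ^ 3 :=
    Finset.sum_sq_le_sum_mul_sum_of_sq_le_mul _ (fun i _ => hx i)
      (fun i _ => pow_nonneg (hx i) 3) (fun i _ => by ring_nf; rfl)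
  have h₂ : (∑ i, x i ^ 3) ^ 2 ≤ (∑ i, x i ^ 2) * ∑ i, x i ^ 4 :=
    Finset.sum_sq_le_sum_mul_sum_of_sq_le_mul _ (fun i _ => pow_nonneg (hx i) 2)
      (fun i _ => pow_nonneg (hx i) 4) (fun i _ => by ring_nf; rfl)
  have hnonneg : ∀ k, 0 ≤ ∑ i, x i ^ k := fun k =>
    Finset.sum_nonneg fun i _ => pow_nonneg (hx i) k
  rcases (hnonneg 2).eq_or_lt with h0 | hpos
  · rw [← h0]
    simpa using mul_nonneg (sq_nonneg (∑ i, x i)) (hnonneg 4)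
  · refine le_of_mul_le_mul_left ?_ hpos
    calc (∑ i, x i ^ 2) * (∑ i, x i ^ 2) ^ 3 = ((∑ i, x i ^ 2) ^ 2) ^ 2 := by ring
      _ ≤ ((∑ i, x i) * ∑ i, x i ^ 3) ^ 2 := by gcongr
      _ = (∑ i, x i) ^ 2 * (∑ i, x i ^ 3) ^ 2 := by ring
      _ ≤ (∑ i, x i) ^ 2 * ((∑ i, x i ^ 2) * ∑ i, x i ^ 4) := by gcongr
      _ = _ := by ring

/-- The pseudo-inverse square root `S` of a positive semidefinite matrix `ρ`: `S ρ S` is a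
contraction and `tr (S ρ) = tr (ρ ^ (1/2))` obeys Hölder's inequality. -/
lemma Matrix.PosSemidef.exists_pseudoInverse_sqrt {H : Type*} [Fintype H] [DecidableEq H]
    {ρ : Matrix H H ℂ} (hρ : ρ.PosSemidef) :
    ∃ S : Matrix H H ℂ, S.IsHermitian ∧ (1 - S * ρ * S).PosSemidef ∧
      ρ.trace.re ^ 3 ≤ (S * ρ).trace.re ^ 2 * (ρ * ρ).trace.re := by
  set φ := Unitary.conjStarAlgAut ℂ (Matrix H H ℂ) hρ.isHermitian.eigenvectorUnitary with hφ
  have htrace : ∀ M, (φ M).trace = M.trace := fun M => by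
    rw [hφ, Unitary.conjStarAlgAut_apply, Matrix.trace_mul_comm, ← mul_assoc]
    simp
  set x : H → ℝ := fun i => √(hρ.isHermitian.eigenvalues i) with hx
  have hρφ : ρ = φ (Matrix.diagonal fun i => ((x i ^ 2 : ℝ) : ℂ)) := by
    conv_lhs => rw [hρ.isHermitian.spectral_theorem]
    congr 2
    funext i
    simp [hx, Real.sq_sqrt (hρ.eigenvalues_nonneg i)]
  have hinv : ∀ i, (x i)⁻¹ * x i ^ 2 = x i := fun i => by
    rcases eq_or_ne (x i) 0 with h | h
    · simp [h]
    · field_simp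
  have hpos : ∀ D : H → ℝ, (∀ i, 0 ≤ D i) →
      (φ (Matrix.diagonal fun i => (D i : ℂ))).PosSemidef := fun D hD => by
    rw [hφ, Unitary.conjStarAlgAut_apply]
    exact (Matrix.PosSemidef.diagonal fun i =>
      Complex.zero_le_real.2 (hD i)).mul_mul_conjTranspose_same _
  have hx0 : ∀ i, 0 ≤ x i := fun i => Real.sqrt_nonneg _
  clear_value x φ
  refine ⟨φ (Matrix.diagonal fun i => (((x i)⁻¹ : ℝ) : ℂ)),
    (hpos _ fun i => inv_nonneg.2 (hx0 i)).isHermitian, ?_, ?_⟩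
  · convert hpos (fun i => 1 - x i * (x i)⁻¹) fun i => ?_ using 1
    · conv_lhs => rw [hρφ, ← map_one φ, ← map_mul, ← map_mul, ← map_sub]
      rw [Matrix.diagonal_mul_diagonal, Matrix.diagonal_mul_diagonal, ← Matrix.diagonal_one,
        Matrix.diagonal_sub]
      congr 2
      funext i
      rw [← Complex.ofReal_mul, hinv]
      push_cast
      rfl
    · exact sub_nonneg.2 mul_inv_le_one
  · rw [hρφ, ← map_mul, ← map_mul, htrace, htrace, htrace, Matrix.diagonal_mul_diagonal,
      Matrix.diagonal_mul_diagonal]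
    simp only [Matrix.trace_diagonal, ← Complex.ofReal_mul, ← Complex.ofReal_sum,
      Complex.ofReal_re, hinv]
    convert sum_sq_pow_three_le x hx0 using 4
    ring

/-- The squared Hilbert-Schmidt distance between `η S η` and a multiple of `η`, where `η` is a
state proportional to a projection. -/
lemma trace_conjTranspose_mul_self_compression_sub {H : Type*} [Fintype H]
    {η S : Matrix H H ℂ} {κ : ℝ} {c : ℝ} (hη : η.IsHermitian) (hS : S.IsHermitian)
    (hsq : η * η = (κ : ℂ) • η) (htr : η.trace = 1) :
    ((η * S * η - (c : ℂ) • η).conjTranspose * (η * S * η - (c : ℂ) • η)).trace =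
      κ ^ 2 * (S * η * S * η).trace - 2 * c * κ ^ 2 * (S * η).trace + c ^ 2 * κ := by
  have hadj : (η * S * η - (c : ℂ) • η).conjTranspose = η * S * η - (c : ℂ) • η := by
    simp [Matrix.conjTranspose_sub, Matrix.conjTranspose_mul, Matrix.conjTranspose_smul,
      hη.eq, hS.eq, mul_assoc]
  have h₁ : (η * S * η * (η * S * η)).trace = κ ^ 2 * (S * η * S * η).trace := by
    rw [show η * S * η * (η * S * η) = η * (S * (η * η) * S * η) by simp only [mul_assoc],
      Matrix.trace_mul_comm, mul_assoc _ η η, hsq]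
    simp only [smul_mul_assoc, mul_smul_comm, Matrix.trace_smul, smul_eq_mul]
    ring
  have h₂ : (η * S * η * η).trace = κ ^ 2 * (S * η).trace := by
    rw [mul_assoc, mul_assoc, Matrix.trace_mul_comm, hsq]
    simp only [smul_mul_assoc, mul_smul_comm, Matrix.trace_smul, smul_eq_mul, mul_assoc, hsq]
    ring
  have h₃ : (η * (η * S * η)).trace = κ ^ 2 * (S * η).trace := by
    rw [Matrix.trace_mul_comm, h₂]
  rw [hadj, sub_mul, mul_sub, mul_sub]
  simp only [smul_mul_assoc, mul_smul_comm, Matrix.trace_smul, Matrix.trace_sub, smul_eq_mul,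
    h₁, h₂, h₃, hsq, htr]
  ring

/-- Square-root measurement for a uniform ensemble of states proportional to projections:
the total success weight is bounded below through the purity of the ensemble. -/
lemma exists_isPOVM_purity_bound {H : Type*} [Fintype H] [DecidableEq H] {N : ℕ} (hN : 1 ≤ N)
    (η : Fin N → Matrix H H ℂ) (κ T : ℝ) (hκ : 0 < κ) (hT : 0 < T)
    (hherm : ∀ i, (η i).IsHermitian) (hsq : ∀ i, η i * η i = (κ : ℂ) • η i)
    (htr : ∀ i, (η i).trace = 1) (hpurity : ((∑ i, η i) * ∑ i, η i).trace = T) :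
    ∃ E : Fin N → Matrix H H ℂ, IsPOVM E ∧
      κ * N ^ 2 / T ≤ ∑ i, ((E i * η i).trace).re := by
  have hN' : (0 : ℝ) < N := by exact_mod_cast hN
  have hpsd : ∀ i, (η i).PosSemidef := fun i => by
    have h := (Matrix.posSemidef_conjTranspose_mul_self (η i)).smul
      (Complex.zero_le_real.2 (inv_nonneg.2 hκ.le))
    rwa [(hherm i).eq, hsq, smul_smul, ← Complex.ofReal_mul, inv_mul_cancel₀ hκ.ne',
      Complex.ofReal_one, one_smul] at h
  obtain ⟨S, hS, hcontr, hholder⟩ :=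
    (Matrix.posSemidef_sum Finset.univ fun i _ => hpsd i).exists_pseudoInverse_sqrt
  set τ := (S * ∑ i, η i).trace.re with hτ
  rw [hpurity, Matrix.trace_sum, Finset.sum_congr rfl fun i _ => htr i] at hholder
  simp only [Finset.sum_const, Finset.card_univ, Fintype.card_fin, nsmul_eq_mul, mul_one,
    Complex.natCast_re, Complex.ofReal_re] at hholder
  have hconj : ∀ {M : Matrix H H ℂ}, M.PosSemidef → (S * M * S).PosSemidef := fun {M} hM => by
    simpa only [hS.eq] using hM.mul_mul_conjTranspose_same S
  have hrem : ((((N : ℝ)⁻¹ : ℝ) : ℂ) • (1 - S * (∑ i, η i) * S)).PosSemidef :=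
    hcontr.smul (Complex.zero_le_real.2 (inv_nonneg.2 hN'.le))
  refine ⟨fun i => S * η i * S + (((N : ℝ)⁻¹ : ℝ) : ℂ) • (1 - S * (∑ i, η i) * S),
    ⟨fun i => (hconj (hpsd i)).add hrem, ?_⟩, ?_⟩
  · rw [Finset.sum_add_distrib, ← Finset.sum_mul, ← Finset.mul_sum, Finset.sum_const,
      Finset.card_univ, Fintype.card_fin, ← Nat.cast_smul_eq_nsmul ℂ, smul_smul]
    have : (N : ℂ) ≠ 0 := by exact_mod_cast hN'.ne'
    simp [this]
  · set c := κ * τ / N with hc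
    have hterm : ∀ i, 2 * c * (S * η i).trace.re - c ^ 2 / κ ≤
        (((S * η i * S + (((N : ℝ)⁻¹ : ℝ) : ℂ) • (1 - S * (∑ i, η i) * S)) * η i).trace).re := by
      intro i
      have hrest : 0 ≤ ((((N : ℝ)⁻¹ : ℝ) : ℂ) • (1 - S * (∑ i, η i) * S) * η i).trace.re := by
        have h := (hrem.conjTranspose_mul_mul_same (η i)).trace_nonneg
        rw [(hherm i).eq, mul_assoc, Matrix.trace_mul_comm, mul_assoc, hsq, mul_smul_comm,
          Matrix.trace_smul, smul_eq_mul] at h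
        have h' := (Complex.le_def.1 h).1
        rw [Complex.re_ofReal_mul, Complex.zero_re] at h'
        exact nonneg_of_mul_nonneg_right h' hκ
      have hsquare : κ ^ 2 * (S * η i * S * η i).trace.re - 2 * c * κ ^ 2 * (S * η i).trace.re
          + c ^ 2 * κ = (((η i * S * η i - (c : ℂ) • η i).conjTranspose *
            (η i * S * η i - (c : ℂ) • η i)).trace).re := by
        rw [trace_conjTranspose_mul_self_compression_sub (hherm i) hS (hsq i) (htr i)]
        simp [← Complex.ofReal_pow, mul_assoc]
      have hnonneg := (Complex.le_def.1 (Matrix.posSemidef_conjTranspose_mul_self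
        (η i * S * η i - (c : ℂ) • η i)).trace_nonneg).1
      rw [← hsquare, Complex.zero_re] at hnonneg
      rw [add_mul, Matrix.trace_add, Complex.add_re]
      refine le_add_of_le_of_nonneg ?_ hrest
      refine le_of_mul_le_mul_left ?_ (pow_pos hκ 2)
      have : κ ^ 2 * (c ^ 2 / κ) = c ^ 2 * κ := by field_simp
      linarith
    refine le_trans ?_ (Finset.sum_le_sum fun i _ => hterm i)
    have hsum : ∑ i, (S * η i).trace.re = τ := by
      rw [hτ, Finset.mul_sum, Matrix.trace_sum, Complex.re_sum]
    rw [Finset.sum_sub_distrib, ← Finset.mul_sum, hsum, Finset.sum_const, Finset.card_univ,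
      Fintype.card_fin, nsmul_eq_mul]
    have : 2 * c * τ - N * (c ^ 2 / κ) = κ * τ ^ 2 / N := by
      rw [hc]; field_simp; ring
    rw [this, div_le_div_iff₀ hT hN']
    nlinarith [mul_le_mul_of_nonneg_left hholder hκ.le]

lemma etaPBT_isHermitian (d N : ℕ) (i : Fin N) : (etaPBT d N i).IsHermitian := by
  ext p q
  simp only [etaPBT, Matrix.conjTranspose_apply, Matrix.of_apply]
  have : (q.1 = q.2 i ∧ p.1 = p.2 i ∧ ∀ j, j ≠ i → q.2 j = p.2 j) ↔
      (p.1 = p.2 i ∧ q.1 = q.2 i ∧ ∀ j, j ≠ i → p.2 j = q.2 j) := by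
    constructor <;> exact fun ⟨h₁, h₂, h₃⟩ => ⟨h₂, h₁, fun j hj => (h₃ j hj).symm⟩
  rw [if_congr this rfl rfl]
  split_ifs <;> simp

lemma etaPBT_trace (d N : ℕ) (hd : 1 ≤ d) (i : Fin N) : (etaPBT d N i).trace = 1 := by
  have : (d : ℂ) ≠ 0 := by exact_mod_cast (by omega : d ≠ 0)
  simp only [Matrix.trace, Matrix.diag_apply, etaPBT, Matrix.of_apply, Fintype.sum_prod_type_right]
  simp [this]

lemma etaPBT_mul_self (d N : ℕ) (hd : 1 ≤ d) (i : Fin N) :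
    etaPBT d N i * etaPBT d N i = ((d / (d : ℝ) ^ N : ℝ) : ℂ) • etaPBT d N i := by
  have hd' : (d : ℂ) ≠ 0 := by exact_mod_cast (by omega : d ≠ 0)
  ext p q
  have hcard : (Finset.univ.filter fun m : Fin d × (Fin N → Fin d) =>
      m.1 = m.2 i ∧ ∀ j, j ≠ i → p.2 j = m.2 j).card = d := by
    have himage : (Finset.univ.filter fun m : Fin d × (Fin N → Fin d) =>
        m.1 = m.2 i ∧ ∀ j, j ≠ i → p.2 j = m.2 j) =
        Finset.univ.image fun a => (a, Function.update p.2 i a) := by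
      ext ⟨a, f⟩
      simp only [Finset.mem_filter, Finset.mem_univ, true_and, Finset.mem_image, Prod.mk.injEq,
        exists_eq_left, Function.update_eq_iff]
    rw [himage, Finset.card_image_of_injective _ fun a b h => (Prod.mk.inj h).1,
      Finset.card_univ, Fintype.card_fin]
  have hfactor : ∀ m, etaPBT d N i p m * etaPBT d N i m q =
      (1 / (d : ℂ) ^ N) * etaPBT d N i p q *
        if m.1 = m.2 i ∧ ∀ j, j ≠ i → p.2 j = m.2 j then 1 else 0 := fun m => by
    by_cases hm : m.1 = m.2 i ∧ ∀ j, j ≠ i → p.2 j = m.2 j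
    · have hpm : (∀ j, j ≠ i → m.2 j = q.2 j) ↔ ∀ j, j ≠ i → p.2 j = q.2 j :=
        forall₂_congr fun j hj => by rw [hm.2 j hj]
      simp only [etaPBT, Matrix.of_apply, hm, hpm]
      split_ifs <;> simp_all
    · rw [if_neg hm, etaPBT, Matrix.of_apply, if_neg fun h => hm h.2]
      simp
  rw [Matrix.mul_apply, Finset.sum_congr rfl fun m _ => hfactor m, ← Finset.mul_sum,
    Finset.sum_boole, hcard, Matrix.smul_apply, smul_eq_mul]
  push_cast
  ring

lemma card_filter_apply_eq_apply (d N : ℕ) {i j : Fin N} (hij : i ≠ j) :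
    (Finset.univ.filter fun f : Fin N → Fin d => f i = f j).card = d ^ (N - 1) := by
  rw [← Fintype.card_subtype]
  have e : {f : Fin N → Fin d // f i = f j} ≃ ({k : Fin N // k ≠ j} → Fin d) :=
    { toFun := fun f k => f.1 k
      invFun := fun g => ⟨(Equiv.funSplitAt j (Fin d)).symm (g ⟨i, hij⟩, g), by
        simp [Equiv.funSplitAt, Equiv.piSplitAt, hij]⟩
      left_inv := fun ⟨f, hf⟩ => by
        ext k
        by_cases hk : k = j <;> simp [Equiv.funSplitAt, Equiv.piSplitAt, hk, hf]
      right_inv := fun g => by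
        ext k
        simp [Equiv.funSplitAt, Equiv.piSplitAt, k.2] }
  rw [Fintype.card_congr e]
  simp

lemma etaPBT_trace_mul_of_ne (d N : ℕ) (hd : 1 ≤ d) {i j : Fin N} (hij : i ≠ j) :
    (etaPBT d N i * etaPBT d N j).trace = ((1 / (d * (d : ℝ) ^ N) : ℝ) : ℂ) := by
  have hd' : (d : ℂ) ≠ 0 := by exact_mod_cast (by omega : d ≠ 0)
  have hdiag : ∀ p, (etaPBT d N i * etaPBT d N j) p p =
      if p.1 = p.2 i ∧ p.2 i = p.2 j then 1 / ((d : ℂ) ^ N) ^ 2 else 0 := fun p => by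
    rw [Matrix.mul_apply, Finset.sum_eq_single p]
    · simp only [etaPBT, Matrix.of_apply]
      split_ifs <;> simp_all [sq]
    · intro q _ hqp
      simp only [etaPBT, Matrix.of_apply]
      by_contra hne
      obtain ⟨h₁, h₂⟩ := mul_ne_zero_iff.1 hne
      obtain ⟨hp, hq, hpq⟩ := of_not_not fun h => h₁ (if_neg h)
      obtain ⟨-, -, hqp'⟩ := of_not_not fun h => h₂ (if_neg h)
      have hsnd : q.2 = p.2 := funext fun k => by
        by_cases hk : k = i
        · exact hqp' k (hk ▸ hij)
        · exact (hpq k hk).symm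
      exact hqp (Prod.ext (by rw [hp, hq, hsnd]) hsnd)
    · simp
  simp only [Matrix.trace, Matrix.diag_apply, hdiag, Fintype.sum_prod_type_right, ite_and]
  simp only [Finset.sum_ite_eq', Finset.mem_univ, if_true]
  rw [← Finset.sum_filter, Finset.sum_const, card_filter_apply_eq_apply d N hij, nsmul_eq_mul]
  have hpow : (d : ℂ) ^ N = d ^ (N - 1) * d := by
    rw [← pow_succ, Nat.sub_add_cancel i.pos]
  push_cast
  rw [hpow]
  field_simp

lemma etaPBT_purity (d N : ℕ) (hd : 1 ≤ d) :
    ((∑ i, etaPBT d N i) * ∑ i, etaPBT d N i).trace =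
      ((N * (d ^ 2 + N - 1) / (d * (d : ℝ) ^ N) : ℝ) : ℂ) := by
  have hd' : (d : ℂ) ≠ 0 := by exact_mod_cast (by omega : d ≠ 0)
  have hrow : ∀ i, ∑ j, (etaPBT d N i * etaPBT d N j).trace =
      (((d ^ 2 + N - 1) / (d * (d : ℝ) ^ N) : ℝ) : ℂ) := fun i => by
    have hN : 1 ≤ N := Fin.pos i
    rw [← Finset.add_sum_erase _ _ (Finset.mem_univ i), Finset.sum_congr rfl fun j hj =>
      etaPBT_trace_mul_of_ne d N hd (Finset.ne_of_mem_erase hj).symm, etaPBT_mul_self d N hd,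
      Matrix.trace_smul, etaPBT_trace d N hd, Finset.sum_const,
      Finset.card_erase_of_mem (Finset.mem_univ i), Finset.card_univ, Fintype.card_fin,
      nsmul_eq_mul, smul_eq_mul, Nat.cast_sub hN]
    push_cast
    field_simp
    ring
  rw [Finset.sum_mul_sum, Matrix.trace_sum, Finset.sum_congr rfl fun i _ =>
    (Matrix.trace_sum _ _).trans (hrow i), Finset.sum_const, Finset.card_univ, Fintype.card_fin,
    nsmul_eq_mul]
  push_cast
  ring

/-- **Discrimination of the port-based teleportation ensemble.**
There is a POVM `{E^i}_{i=1}^N` on `A ⊗ A'^N` distinguishing the states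
`η^i = |Φ_d⟩⟨Φ_d|_{A'_i A} ⊗ ⨂_{j≠i}(I_d/d)` with uniform prior with average success
probability at least `(d²/N)(1 − (d²−1)/N)`. -/
theorem pbt_ensemble_discrimination (d N : ℕ) (hd : 1 ≤ d) (hN : 1 ≤ N) :
    ∃ E : Fin N → Matrix (Fin d × (Fin N → Fin d)) (Fin d × (Fin N → Fin d)) ℂ,
      IsPOVM E ∧
      ((d : ℝ) ^ 2 / N) * (1 - ((d : ℝ) ^ 2 - 1) / N) ≤
        (1 / (N : ℝ)) * ∑ i, ((E i * etaPBT d N i).trace).re := by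
  have hd' : (0 : ℝ) < d := by exact_mod_cast hd
  have hN' : (1 : ℝ) ≤ N := by exact_mod_cast hN
  have hpos : 0 < (d : ℝ) ^ 2 + N - 1 := by nlinarith [sq_pos_of_pos hd']
  obtain ⟨E, hE, hbound⟩ := exists_isPOVM_purity_bound hN (etaPBT d N) (d / (d : ℝ) ^ N)
    (N * (d ^ 2 + N - 1) / (d * (d : ℝ) ^ N)) (by positivity) (by positivity)
    (etaPBT_isHermitian d N) (etaPBT_mul_self d N hd) (etaPBT_trace d N hd)
    (etaPBT_purity d N hd)
  refine ⟨E, hE, le_trans ?_ (mul_le_mul_of_nonneg_left hbound (by positivity))⟩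
  have hvalue : 1 / (N : ℝ) * (d / (d : ℝ) ^ N * N ^ 2 /
      (N * (d ^ 2 + N - 1) / (d * (d : ℝ) ^ N))) = d ^ 2 / (d ^ 2 + N - 1) := by
    field_simp
  rw [hvalue, le_div_iff₀ hpos]
  have hfactor : (d : ℝ) ^ 2 / N * (1 - ((d : ℝ) ^ 2 - 1) / N) * (d ^ 2 + N - 1) =
      d ^ 2 * (1 - (((d : ℝ) ^ 2 - 1) / N) ^ 2) := by
    field_simp
    ring
  rw [hfactor]
  nlinarith [mul_nonneg (sq_nonneg (d : ℝ)) (sq_nonneg (((d : ℝ) ^ 2 - 1) / N))]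
end
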